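/- arXiv:math/0411216 — 2 statements merged into one kernel-verified Lean document; each statement's English description precedes it below -/
import Mathlib

section
/- Let n ≥ 3, let e be a compact subset of ℝⁿ of positive capacity with equilibrium measure μ, and let v = (Pμ)^τ where Pμ is the Newtonian potential of μ and 1 < 2τ < n/(n-2). Then v ∈ L^{1,2}(ℝⁿ) and ‖∇v‖_{L²(ℝⁿ)} = τ (2τ - 1)^{-1/2} cap(e)^{1/2}. -/
open MeasureTheory

noncomputable section

/-- Euclidean space ℝⁿ. -/
abbrev V (n : ℕ) := EuclideanSpace ℝ (Fin n)

/-- A real-valued smooth compactly supported test function. -/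
def IsTestR {n : ℕ} (u : V n → ℝ) : Prop := ContDiff ℝ (⊤ : ℕ∞) u ∧ HasCompactSupport u

/-- The homogeneous capacity
`cap(e) = inf { ‖∇u‖²_{L²} : u ∈ C_c^∞(ℝⁿ), u ≥ 1 on e }`. -/
noncomputable def cap (n : ℕ) (e : Set (V n)) : ℝ :=
  sInf {t : ℝ | ∃ u : V n → ℝ, IsTestR u ∧ (∀ x ∈ e, 1 ≤ u x) ∧
    t = ∫ x : V n, ‖fderiv ℝ u x‖ ^ 2}

/-- The Newtonian potential `Pμ(x) = c(n) ∫ |x-y|^{2-n} dμ(y)` of a measure `μ`, with the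
normalizing constant `c(n) = ((n-2) σ_{n-1})⁻¹`, `σ_{n-1} = n ω_n`. -/
noncomputable def Ppot (n : ℕ) (μ : Measure (V n)) (x : V n) : ℝ :=
  (((n : ℝ) - 2) * (n : ℝ) * (volume (Metric.ball (0 : V n) 1)).toReal)⁻¹ *
    ∫ y, ‖x - y‖ ^ (2 - (n : ℝ)) ∂μ

open Filter Topology

/-- The standard orthonormal basis vectors of `ℝⁿ`. -/
abbrev stdVec (n : ℕ) (i : Fin n) : V n := EuclideanSpace.basisFun (Fin n) ℝ i

/-- The Euclidean inner product of two linear functionals on `ℝⁿ`. -/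
def dot {n : ℕ} (L M : V n →L[ℝ] ℝ) : ℝ := ∑ i, L (stdVec n i) * M (stdVec n i)

/-- The Laplacian of a twice differentiable function on `ℝⁿ`. -/
def lap {n : ℕ} (F : V n → ℝ) (x : V n) : ℝ :=
  ∑ i, fderiv ℝ (fderiv ℝ F) x (stdVec n i) (stdVec n i)

section Dot

variable {n : ℕ} (L M N : V n →L[ℝ] ℝ) (c : ℝ)

lemma dot_self : dot L L = ‖L‖ ^ 2 := by
  obtain ⟨v, rfl⟩ := (InnerProductSpace.toDual ℝ (V n)).surjective L
  have h := (EuclideanSpace.basisFun (Fin n) ℝ).sum_sq_norm_inner_left v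
  simp only [dot, InnerProductSpace.toDual_apply_apply, LinearIsometryEquiv.norm_map]
  rw [← h]
  refine Finset.sum_congr rfl fun i _ => ?_
  rw [Real.norm_eq_abs, sq_abs, sq]

lemma dot_comm : dot L M = dot M L := by simp only [dot, mul_comm]

lemma dot_add_left : dot (L + M) N = dot L N + dot M N := by
  simp [dot, add_mul, Finset.sum_add_distrib]

lemma dot_sub_left : dot (L - M) N = dot L N - dot M N := by
  simp [dot, sub_mul, Finset.sum_sub_distrib]

lemma dot_smul_left : dot (c • L) M = c * dot L M := by
  simp [dot, Finset.mul_sum, mul_assoc]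

lemma dot_sub_right : dot N (L - M) = dot N L - dot N M := by
  simp [dot, mul_sub, Finset.sum_sub_distrib]

lemma dot_smul_right : dot L (c • M) = c * dot L M := by
  rw [dot_comm, dot_smul_left, dot_comm]

lemma two_mul_dot_sub_le : 2 * c * dot L M - c ^ 2 * ‖M‖ ^ 2 ≤ ‖L‖ ^ 2 := by
  have h := sq_nonneg ‖L - c • M‖
  rw [← dot_self] at h
  rw [dot_sub_left, dot_sub_right, dot_sub_right, dot_smul_left, dot_smul_left, dot_smul_right,
    dot_smul_right, dot_self, dot_self, dot_comm M L] at h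
  nlinarith

lemma continuous_dot {X : Type*} [TopologicalSpace X] {f g : X → V n →L[ℝ] ℝ}
    (hf : Continuous f) (hg : Continuous g) : Continuous fun x => dot (f x) (g x) := by
  unfold dot
  fun_prop

end Dot

/-- `‖a + b‖² ≤ (1 + η) ‖a‖² + (1 + 1/η) ‖b‖²`. -/
lemma norm_add_sq_le_eta {E : Type*} [NormedAddCommGroup E] (a b : E) {η : ℝ} (hη : 0 < η) :
    ‖a + b‖ ^ 2 ≤ (1 + η) * ‖a‖ ^ 2 + (1 + η⁻¹) * ‖b‖ ^ 2 := by
  have h1 : ‖a + b‖ ^ 2 ≤ (‖a‖ + ‖b‖) ^ 2 := by gcongr; exact norm_add_le a b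
  have h2 : 0 ≤ η⁻¹ * (η * ‖a‖ - ‖b‖) ^ 2 := by positivity
  have h3 : η⁻¹ * (η * ‖a‖ - ‖b‖) ^ 2 = η * ‖a‖ ^ 2 - 2 * ‖a‖ * ‖b‖ + η⁻¹ * ‖b‖ ^ 2 := by
    field_simp
    ring
  nlinarith

lemma IsTestR.contDiff_two {n : ℕ} {u : V n → ℝ} (hu : IsTestR u) : ContDiff ℝ 2 u := by
  exact_mod_cast contDiff_infty.1 hu.1 2

section Parts

variable {n : ℕ}

lemma continuous_lap {F : V n → ℝ} (hF : ContDiff ℝ 2 F) : Continuous (lap F) := by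
  have h1 : ContDiff ℝ 1 (fderiv ℝ F) := hF.fderiv_right (by norm_num)
  have h2 : Continuous (fderiv ℝ (fderiv ℝ F)) := h1.continuous_fderiv (by norm_num)
  unfold lap
  fun_prop

lemma lap_sub {F G : V n → ℝ} (hF : ContDiff ℝ 2 F) (hG : ContDiff ℝ 2 G) (x : V n) :
    lap (fun y => F y - G y) x = lap F x - lap G x := by
  have hF1 : ContDiff ℝ 1 (fderiv ℝ F) := hF.fderiv_right (by norm_num)
  have hG1 : ContDiff ℝ 1 (fderiv ℝ G) := hG.fderiv_right (by norm_num)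
  have h : fderiv ℝ (fun y => F y - G y) = fun y => fderiv ℝ F y - fderiv ℝ G y := by
    ext1 y
    exact fderiv_fun_sub (hF.differentiable (by norm_num) y) (hG.differentiable (by norm_num) y)
  unfold lap
  rw [h, fderiv_fun_sub (hF1.differentiable (by norm_num) x) (hG1.differentiable (by norm_num) x)]
  simp

/-- Integration by parts against the Laplacian. -/
lemma integral_dot_fderiv {u F : V n → ℝ} (hu : ContDiff ℝ 1 u) (hF : ContDiff ℝ 2 F)
    (hs : HasCompactSupport u ∨ HasCompactSupport F) :
    ∫ x, dot (fderiv ℝ u x) (fderiv ℝ F x) = - ∫ x, u x * lap F x := by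
  have hF1 : ContDiff ℝ 1 (fderiv ℝ F) := hF.fderiv_right (by norm_num)
  have hFc : Continuous (fderiv ℝ F) := hF1.continuous
  have hF2 : Continuous (fderiv ℝ (fderiv ℝ F)) := hF1.continuous_fderiv (by norm_num)
  have huc : Continuous (fderiv ℝ u) := hu.continuous_fderiv (by norm_num)
  have hu0 : Continuous u := hu.continuous
  have key : ∀ i : Fin n,
      Integrable (fun x => fderiv ℝ u x (stdVec n i) * fderiv ℝ F x (stdVec n i)) ∧
      Integrable (fun x => u x * fderiv ℝ (fderiv ℝ F) x (stdVec n i) (stdVec n i)) ∧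
      ∫ x, u x * fderiv ℝ (fderiv ℝ F) x (stdVec n i) (stdVec n i) =
        - ∫ x, fderiv ℝ u x (stdVec n i) * fderiv ℝ F x (stdVec n i) := by
    intro i
    set v := stdVec n i
    have c1 : Continuous (fun x => fderiv ℝ u x v * fderiv ℝ F x v) := by fun_prop
    have c2 : Continuous (fun x => u x * fderiv ℝ (fderiv ℝ F) x v v) := by fun_prop
    have c3 : Continuous (fun x => u x * fderiv ℝ F x v) := by fun_prop
    have hg : ∀ x, fderiv ℝ (fun y => fderiv ℝ F y v) x v = fderiv ℝ (fderiv ℝ F) x v v := by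
      intro x
      rw [fderiv_clm_apply (hF1.differentiable (by norm_num) x) (differentiableAt_const v)]
      simp
    have s : HasCompactSupport (fun x => fderiv ℝ u x v * fderiv ℝ F x v) ∧
        HasCompactSupport (fun x => u x * fderiv ℝ (fderiv ℝ F) x v v) ∧
        HasCompactSupport (fun x => u x * fderiv ℝ F x v) := by
      rcases hs with hs | hs
      · exact ⟨(hs.fderiv_apply ℝ v).mul_right, hs.mul_right, hs.mul_right⟩
      · refine ⟨(hs.fderiv_apply ℝ v).mul_left, ?_, (hs.fderiv_apply ℝ v).mul_left⟩
        have := ((hs.fderiv ℝ).fderiv_apply ℝ v)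
        refine HasCompactSupport.mul_left ?_
        exact this.comp_left (g := fun L : V n →L[ℝ] ℝ => L v) (by simp)
    have i1 := c1.integrable_of_hasCompactSupport s.1 (μ := volume)
    have i2 := c2.integrable_of_hasCompactSupport s.2.1 (μ := volume)
    have i3 := c3.integrable_of_hasCompactSupport s.2.2 (μ := volume)
    refine ⟨i1, i2, ?_⟩
    have := integral_mul_fderiv_eq_neg_fderiv_mul_of_integrable (μ := (volume : Measure (V n)))
      (f := u) (g := fun y => fderiv ℝ F y v) (v := v) i1 (by simpa only [hg] using i2) i3
      (fun x _ => hu.differentiable (by norm_num) x)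
      (fun x _ => (hF1.differentiable (by norm_num) x).clm_apply (differentiableAt_const v))
    simpa only [hg] using this
  simp only [dot, lap, Finset.mul_sum]
  rw [integral_finsetSum _ fun i _ => (key i).1, integral_finsetSum _ fun i _ => (key i).2.1,
    ← Finset.sum_neg_distrib]
  exact Finset.sum_congr rfl fun i _ => by rw [(key i).2.2, neg_neg]

/-- Picone's inequality: for a positive `W` and a compactly supported `u`, the integral of
`u² (-ΔW) / W` is bounded by the Dirichlet integral of `u`. -/
lemma integral_picone_le {u W : V n → ℝ} (hu : ContDiff ℝ 1 u) (hs : HasCompactSupport u)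
    (hW : ContDiff ℝ 2 W) (hpos : ∀ x, 0 < W x) :
    ∫ x, u x ^ 2 * (-lap W x) / W x ≤ ∫ x, ‖fderiv ℝ u x‖ ^ 2 := by
  have hW1 : ContDiff ℝ 1 W := hW.of_le (by norm_num)
  have hne : ∀ x, W x ≠ 0 := fun x => (hpos x).ne'
  have hψ : ContDiff ℝ 1 (fun x => u x ^ 2 * (W x)⁻¹) := (hu.pow 2).mul (hW1.inv hne)
  have hsq : HasCompactSupport fun x => u x ^ 2 :=
    hs.comp_left (g := fun r : ℝ => r ^ 2) (by simp)
  have hψs : HasCompactSupport (fun x => u x ^ 2 * (W x)⁻¹) := hsq.mul_right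
  have huc : Continuous (fderiv ℝ u) := hu.continuous_fderiv (by norm_num)
  have hWc : Continuous (fderiv ℝ W) := hW1.continuous_fderiv (by norm_num)
  have hψc : Continuous (fderiv ℝ (fun x => u x ^ 2 * (W x)⁻¹)) :=
    hψ.continuous_fderiv (by norm_num)
  have h := integral_dot_fderiv hψ hW (Or.inl hψs)
  have e1 : ∫ x, u x ^ 2 * (-lap W x) / W x
      = ∫ x, dot (fderiv ℝ (fun x => u x ^ 2 * (W x)⁻¹) x) (fderiv ℝ W x) := by
    rw [h, ← integral_neg]
    refine integral_congr_ae (Eventually.of_forall fun x => ?_)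
    simp only [div_eq_mul_inv]
    ring
  rw [e1]
  refine integral_mono ?_ ?_ fun x => ?_
  · refine (continuous_dot hψc hWc).integrable_of_hasCompactSupport ?_
    exact (hψs.fderiv ℝ).mono fun x hx => by
      contrapose! hx
      simp only [Function.mem_support, not_not] at hx ⊢
      simp [hx, dot]
  · refine Continuous.integrable_of_hasCompactSupport (by fun_prop) ?_
    exact (hs.fderiv ℝ).comp_left (g := fun L : V n →L[ℝ] ℝ => ‖L‖ ^ 2) (by simp)
  · have hd : HasFDerivAt (fun x => u x ^ 2 * (W x)⁻¹)
        ((2 * (u x / W x)) • fderiv ℝ u x - ((u x / W x) ^ 2) • fderiv ℝ W x) x := by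
      have du := (hu.differentiable (by norm_num) x).hasFDerivAt
      have dW := (hW1.differentiable (by norm_num) x).hasFDerivAt
      have dinv := (hasDerivAt_inv (hne x)).comp_hasFDerivAt x dW
      convert! (du.pow 2).mul dinv using 1
      ext v
      have := hne x
      simp
      field_simp
      ring
    dsimp only
    rw [hd.fderiv, dot_sub_left, dot_smul_left, dot_smul_left, dot_self]
    exact two_mul_dot_sub_le _ _ _

/-- The localized energy identity. -/
lemma integral_cutoff_energy {χ w : V n → ℝ} (hχ : ContDiff ℝ 2 χ) (hs : HasCompactSupport χ)
    (hw : ContDiff ℝ 2 w) :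
    ∫ x, χ x * ‖fderiv ℝ w x‖ ^ 2
      = (∫ x, χ x * w x * (-lap w x)) + (1 / 2) * ∫ x, w x ^ 2 * lap χ x := by
  have hχ1 : ContDiff ℝ 1 χ := hχ.of_le (by norm_num)
  have hw1 : ContDiff ℝ 1 w := hw.of_le (by norm_num)
  have hχc : Continuous (fderiv ℝ χ) := hχ1.continuous_fderiv (by norm_num)
  have hwc : Continuous (fderiv ℝ w) := hw1.continuous_fderiv (by norm_num)
  have h1 := integral_dot_fderiv (u := fun x => χ x * w x) (hχ1.mul hw1) hw (Or.inl hs.mul_right)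
  have h2 := integral_dot_fderiv (u := fun x => w x ^ 2) (hw1.pow 2) hχ (Or.inr hs)
  have e1 : ∀ x, dot (fderiv ℝ (fun y => χ y * w y) x) (fderiv ℝ w x)
      = χ x * ‖fderiv ℝ w x‖ ^ 2 + w x * dot (fderiv ℝ w x) (fderiv ℝ χ x) := by
    intro x
    rw [fderiv_fun_mul (hχ1.differentiable (by norm_num) x) (hw1.differentiable (by norm_num) x),
      dot_add_left, dot_smul_left, dot_smul_left, dot_self, dot_comm (fderiv ℝ χ x)]
  have e2 : ∀ x, dot (fderiv ℝ (fun y => w y ^ 2) x) (fderiv ℝ χ x)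
      = 2 * (w x * dot (fderiv ℝ w x) (fderiv ℝ χ x)) := by
    intro x
    rw [fderiv_fun_pow 2 (hw1.differentiable (by norm_num) x), dot_smul_left]
    simp
    ring
  have i1 : Integrable fun x => χ x * ‖fderiv ℝ w x‖ ^ 2 := by
    have := hχ1.continuous
    exact Continuous.integrable_of_hasCompactSupport (by fun_prop) hs.mul_right
  have i2 : Integrable fun x => w x * dot (fderiv ℝ w x) (fderiv ℝ χ x) := by
    refine Continuous.integrable_of_hasCompactSupport
      (hw1.continuous.mul (continuous_dot hwc hχc)) ?_
    refine HasCompactSupport.mul_left ?_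
    exact (hs.fderiv ℝ).mono fun x hx => by
      contrapose! hx
      simp only [Function.mem_support, not_not] at hx ⊢
      simp [hx, dot]
  simp only [e1] at h1
  simp only [e2] at h2
  rw [integral_add i1 i2] at h1
  rw [integral_const_mul] at h2
  simp only [mul_neg, integral_neg]
  linarith

/-- The chain rule combined with integration by parts. -/
lemma integral_comp_energy {φ g : ℝ → ℝ} {F : V n → ℝ} (hφ : ∀ s, HasDerivAt φ (g s) s)
    (hg : Continuous g) (hF : ContDiff ℝ 2 F) (hs : HasCompactSupport fun x => φ (F x)) :
    ∫ x, g (F x) * ‖fderiv ℝ F x‖ ^ 2 = ∫ x, φ (F x) * (-lap F x) := by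
  have hF1 : ContDiff ℝ 1 F := hF.of_le (by norm_num)
  have hφ1 : ContDiff ℝ 1 φ := by
    rw [contDiff_one_iff_deriv]
    refine ⟨fun s => (hφ s).differentiableAt, ?_⟩
    rwa [show deriv φ = g from funext fun s => (hφ s).deriv]
  have h := integral_dot_fderiv (hφ1.comp hF1) hF (Or.inl hs)
  simp only [mul_neg, integral_neg]
  rw [Function.comp_def] at h
  rw [← h]
  refine integral_congr_ae (Eventually.of_forall fun x => ?_)
  have hd := (hφ (F x)).comp_hasFDerivAt x (hF1.differentiable (by norm_num) x).hasFDerivAt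
  rw [Function.comp_def] at hd
  simp only
  rw [hd.fderiv, dot_smul_left, dot_self]

end Parts

/-- The Euclidean inner product as a bilinear map. -/
def ipL (n : ℕ) : V n →L[ℝ] V n →L[ℝ] ℝ := innerSL ℝ

lemma ipL_apply {n : ℕ} (z v : V n) : ipL n z v = inner ℝ z v := rfl

lemma norm_ipL_apply {n : ℕ} (z : V n) : ‖ipL n z‖ = ‖z‖ := innerSL_apply_norm ℝ z

lemma norm_ipL_le {n : ℕ} : ‖ipL n‖ ≤ 1 := norm_innerSL_le ℝ (E := V n)

/-- The regularized power kernel `(‖z‖² + t) ^ p`. -/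
def kern {n : ℕ} (p t : ℝ) (z : V n) : ℝ := (‖z‖ ^ 2 + t) ^ p

section Kern

variable {n : ℕ} {p t : ℝ}

lemma kern_pos (ht : 0 < t) (z : V n) : 0 < kern p t z := by
  unfold kern; positivity

lemma kern_nonneg (ht : 0 ≤ t) (z : V n) : 0 ≤ kern p t z := by
  unfold kern; positivity

lemma contDiff_kern (ht : 0 < t) : ContDiff ℝ ⊤ (kern p t : V n → ℝ) := by
  unfold kern
  exact ((contDiff_norm_sq ℝ).add contDiff_const).rpow_const_of_ne fun z => by positivity

lemma kern_le (ht : 0 < t) (hp : p ≤ 0) (z : V n) : kern p t z ≤ t ^ p :=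
  Real.rpow_le_rpow_of_nonpos ht (by nlinarith [sq_nonneg ‖z‖]) hp

lemma hasFDerivAt_kern {z : V n} (hz : 0 < ‖z‖ ^ 2 + t) :
    HasFDerivAt (kern p t) ((2 * p * kern (p - 1) t z) • ipL n z) z := by
  have h1 : HasFDerivAt (fun z : V n => ‖z‖ ^ 2 + t) (2 • ipL n z) z :=
    (HasStrictFDerivAt.hasFDerivAt (hasStrictFDerivAt_norm_sq z)).add_const t
  have h2 := h1.rpow_const (p := p) (Or.inl hz.ne')
  convert! h2 using 1
  ext v
  simp [kern, ipL_apply]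
  ring

lemma fderiv_kern (ht : 0 < t) :
    fderiv ℝ (kern p t : V n → ℝ) = fun z => (2 * p * kern (p - 1) t z) • ipL n z :=
  funext fun z => (hasFDerivAt_kern (by positivity)).fderiv

lemma kern_mul_norm_le {z : V n} {r : ℝ} (hr : 0 < r) (hz : r ^ 2 ≤ ‖z‖ ^ 2 + t) (ht : 0 ≤ t)
    (hp : p ≤ -(1 / 2)) : kern p t z * ‖z‖ ≤ r ^ (2 * p + 1) := by
  have hq : 0 < ‖z‖ ^ 2 + t := lt_of_lt_of_le (by positivity) hz
  have h1 : ‖z‖ ≤ (‖z‖ ^ 2 + t) ^ (1 / 2 : ℝ) := by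
    rw [← Real.sqrt_eq_rpow]
    exact Real.le_sqrt_of_sq_le (by linarith)
  calc kern p t z * ‖z‖ ≤ (‖z‖ ^ 2 + t) ^ p * (‖z‖ ^ 2 + t) ^ (1 / 2 : ℝ) := by
        unfold kern; gcongr
    _ = (‖z‖ ^ 2 + t) ^ (p + 1 / 2) := by rw [Real.rpow_add hq]
    _ ≤ (r ^ 2) ^ (p + 1 / 2) :=
        Real.rpow_le_rpow_of_nonpos (by positivity) hz (by linarith)
    _ = r ^ (2 * p + 1) := by
        rw [← Real.rpow_natCast, ← Real.rpow_mul hr.le]; congr 1; push_cast; ring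

lemma norm_fderiv_kern_formula_le {z : V n} {r : ℝ} (hr : 0 < r) (hz : r ^ 2 ≤ ‖z‖ ^ 2 + t)
    (ht : 0 ≤ t) (hp : p ≤ 1 / 2) :
    ‖(2 * p * kern (p - 1) t z) • ipL n z‖ ≤ 2 * |p| * r ^ (2 * p - 1) := by
  rw [norm_smul, norm_ipL_apply, Real.norm_eq_abs, abs_mul, abs_mul,
    abs_of_nonneg (kern_nonneg ht z), abs_two, mul_assoc]
  gcongr
  refine (kern_mul_norm_le hr hz ht (by linarith)).trans_eq ?_
  congr 1; ring

lemma fderiv_fderiv_kern (ht : 0 < t) (z : V n) :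
    fderiv ℝ (fderiv ℝ (kern p t)) z = (2 * p * kern (p - 1) t z) • ipL n
      + ((2 * p) • (2 * (p - 1) * kern (p - 1 - 1) t z) • ipL n z).smulRight
        (ipL n z) := by
  rw [fderiv_kern ht]
  have h1 : HasFDerivAt (fun z : V n => 2 * p * kern (p - 1) t z)
      ((2 * p) • (2 * (p - 1) * kern (p - 1 - 1) t z) • ipL n z) z :=
    (hasFDerivAt_kern (by positivity)).const_mul (2 * p)
  exact (h1.smul (ipL n).hasFDerivAt).fderiv

set_option maxSynthPendingDepth 5 in
lemma norm_fderiv_fderiv_kern_le (ht : 0 < t) (hp : p ≤ 0) :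
    ∃ C, ∀ z : V n, ‖fderiv ℝ (fderiv ℝ (kern p t)) z‖ ≤ C := by
  refine ⟨2 * |p| * t ^ (p - 1) + 2 * |p| * (2 * |p - 1| * t ^ (p - 1)), fun z => ?_⟩
  rw [fderiv_fderiv_kern ht]
  refine (norm_add_le ((2 * p * kern (p - 1) t z) • ipL n) _).trans (add_le_add ?_ ?_)
  · rw [norm_smul, Real.norm_eq_abs, abs_mul, abs_mul, abs_two, abs_of_pos (kern_pos ht z)]
    have h1 : ‖ipL n‖ ≤ 1 := norm_ipL_le
    calc 2 * |p| * kern (p - 1) t z * ‖ipL n‖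
        ≤ 2 * |p| * t ^ (p - 1) * 1 := by
          gcongr
          exact kern_le ht (by linarith) z
      _ = _ := mul_one _
  · rw [ContinuousLinearMap.norm_smulRight_apply, norm_smul, norm_smul, norm_ipL_apply,
      Real.norm_eq_abs, Real.norm_eq_abs, abs_mul, abs_mul, abs_mul, abs_two,
      abs_of_pos (kern_pos ht z)]
    have h2 : kern (p - 1 - 1) t z * ‖z‖ * ‖z‖ ≤ t ^ (p - 1) := by
      calc kern (p - 1 - 1) t z * ‖z‖ * ‖z‖ ≤ (‖z‖ ^ 2 + t) ^ (p - 1 - 1) * (‖z‖ ^ 2 + t) := by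
            rw [mul_assoc]
            unfold kern
            gcongr
            nlinarith
        _ = kern (p - 1) t z := by
            unfold kern
            rw [Real.rpow_sub_one (by positivity) (p - 1)]
            field_simp
        _ ≤ t ^ (p - 1) := kern_le ht (by linarith) z
    calc 2 * |p| * (2 * |p - 1| * kern (p - 1 - 1) t z * ‖z‖) * ‖z‖
        = 2 * |p| * (2 * |p - 1| * (kern (p - 1 - 1) t z * ‖z‖ * ‖z‖)) := by ring
      _ ≤ _ := by gcongr

lemma lap_kern (ht : 0 < t) (z : V n) :
    lap (kern p t) z = 2 * p * (n + 2 * (p - 1)) * kern (p - 1) t z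
      - 4 * p * (p - 1) * t * kern (p - 2) t z := by
  have hsum : ∑ i, (z i) ^ 2 = ‖z‖ ^ 2 := by
    rw [EuclideanSpace.norm_sq_eq]; simp
  have hq : 0 < ‖z‖ ^ 2 + t := by positivity
  have hk : kern (p - 1) t z = (‖z‖ ^ 2 + t) * kern (p - 2) t z := by
    unfold kern
    rw [show p - 1 = 1 + (p - 2) by ring, Real.rpow_add hq, Real.rpow_one]
  have e : ∀ i, fderiv ℝ (fderiv ℝ (kern p t)) z (stdVec n i) (stdVec n i)
      = 2 * p * kern (p - 1) t z + 4 * p * (p - 1) * kern (p - 2) t z * (z i) ^ 2 := by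
    intro i
    rw [fderiv_fderiv_kern ht, show p - 1 - 1 = p - 2 by ring]
    have hi : inner ℝ z (stdVec n i) = z i := by
      rw [real_inner_comm]; simp [EuclideanSpace.inner_single_left]
    simp only [add_apply, smul_apply,
      ContinuousLinearMap.smulRight_apply, ipL_apply, hi, smul_eq_mul]
    rw [real_inner_self_eq_norm_sq, OrthonormalBasis.norm_eq_one]
    ring
  simp only [lap, e, Finset.sum_add_distrib, ← Finset.mul_sum, hsum]
  rw [hk]
  simp
  ring

end Kern

/-- Differentiation under the integral sign for the convolution of a finite measure with a
bounded `C¹` function with bounded derivative. -/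
lemma contDiff_one_integral_sub {n : ℕ} {W : Type*} [NormedAddCommGroup W] [NormedSpace ℝ W]
    [FiniteDimensional ℝ W] (μ : Measure (V n)) [IsFiniteMeasure μ] {f : V n → W}
    (hf : ContDiff ℝ 1 f) {C₀ C₁ : ℝ} (h0 : ∀ z, ‖f z‖ ≤ C₀) (h1 : ∀ z, ‖fderiv ℝ f z‖ ≤ C₁) :
    ContDiff ℝ 1 (fun x => ∫ y, f (x - y) ∂μ) ∧
      fderiv ℝ (fun x => ∫ y, f (x - y) ∂μ) = fun x => ∫ y, fderiv ℝ f (x - y) ∂μ := by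
  have hfc := hf.continuous
  have hf'c : Continuous (fderiv ℝ f) := hf.continuous_fderiv (by norm_num)
  have hd : ∀ x, HasFDerivAt (fun x => ∫ y, f (x - y) ∂μ) (∫ y, fderiv ℝ f (x - y) ∂μ) x := by
    intro x
    refine hasFDerivAt_integral_of_dominated_of_fderiv_le (s := Set.univ) (bound := fun _ => C₁)
      (F' := fun x y => fderiv ℝ f (x - y))
      univ_mem (Eventually.of_forall fun x => ?_) ?_ ?_ (ae_of_all _ fun y x _ => h1 _)
      (integrable_const _) (ae_of_all _ fun y x' _ =>
        (?_ : HasFDerivAt (fun x => f (x - y)) (fderiv ℝ f (x' - y)) x'))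
    · exact (by fun_prop : Continuous fun y => f (x - y)).aestronglyMeasurable
    · exact Integrable.of_bound
        (by fun_prop : Continuous fun y => f (x - y)).aestronglyMeasurable C₀
        (ae_of_all _ fun y => h0 _)
    · exact (by fun_prop : Continuous fun y => fderiv ℝ f (x - y)).aestronglyMeasurable
    · have h := ((hf.differentiable (by norm_num) (x' - y)).hasFDerivAt).comp x'
        ((hasFDerivAt_id x').sub_const y)
      simpa [Function.comp_def] using h
  have hfd : fderiv ℝ (fun x => ∫ y, f (x - y) ∂μ) = fun x => ∫ y, fderiv ℝ f (x - y) ∂μ :=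
    funext fun x => (hd x).fderiv
  refine ⟨?_, hfd⟩
  rw [contDiff_one_iff_fderiv]
  refine ⟨fun x => (hd x).differentiableAt, ?_⟩
  rw [hfd]
  refine continuous_of_dominated (bound := fun _ => C₁) (fun x => ?_)
    (fun x => ae_of_all _ fun y => h1 _) (integrable_const _) (ae_of_all _ fun y => ?_)
  · exact (by fun_prop : Continuous fun y => fderiv ℝ f (x - y)).aestronglyMeasurable
  · fun_prop

/-- The normalizing constant of the Newtonian potential. -/
def newtonConst (n : ℕ) : ℝ :=
  (((n : ℝ) - 2) * (n : ℝ) * (volume (Metric.ball (0 : V n) 1)).toReal)⁻¹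

/-- The regularized Newtonian potential. -/
def regPot (n : ℕ) (μ : Measure (V n)) (t : ℝ) (x : V n) : ℝ :=
  newtonConst n * ∫ y, kern (1 - (n : ℝ) / 2) t (x - y) ∂μ

/-- The mollified measure, equal to minus the Laplacian of the regularized potential. -/
def regDens (n : ℕ) (μ : Measure (V n)) (t : ℝ) (x : V n) : ℝ :=
  ∫ y, ((volume (Metric.ball (0 : V n) 1)).toReal)⁻¹ * t * kern (-1 - (n : ℝ) / 2) t (x - y) ∂μ

lemma regPot_zero {n : ℕ} (μ : Measure (V n)) : regPot n μ 0 = Ppot n μ := by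
  funext x
  unfold regPot Ppot newtonConst kern
  congr 2
  funext y
  rw [add_zero, ← Real.rpow_natCast, ← Real.rpow_mul (norm_nonneg _)]
  congr 1
  push_cast
  ring

section RegPot

variable {n : ℕ} (μ : Measure (V n)) [IsFiniteMeasure μ] {t : ℝ}

lemma volume_ball_pos : 0 < (volume (Metric.ball (0 : V n) 1)).toReal :=
  ENNReal.toReal_pos (Metric.measure_ball_pos _ _ one_pos).ne' measure_ball_lt_top.ne

lemma newtonConst_pos (hn : 3 ≤ n) : 0 < newtonConst n := by
  have h : (3 : ℝ) ≤ n := by exact_mod_cast hn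
  have := volume_ball_pos (n := n)
  unfold newtonConst
  have : (0 : ℝ) < n - 2 := by linarith
  positivity

lemma integrable_kern_sub (ht : 0 < t) {p : ℝ} (hp : p ≤ 0) (x : V n) :
    Integrable (fun y => kern p t (x - y)) μ := by
  have hc : Continuous (kern p t : V n → ℝ) := (contDiff_kern ht).continuous
  refine Integrable.of_bound (by fun_prop : Continuous fun y => kern p t (x - y)).aestronglyMeasurable
    (t ^ p) (ae_of_all _ fun y => ?_)
  rw [Real.norm_of_nonneg (kern_nonneg ht.le _)]
  exact kern_le ht hp _

set_option maxSynthPendingDepth 5 in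
lemma contDiff_regPot (hn : 3 ≤ n) (ht : 0 < t) :
    ContDiff ℝ 2 (regPot n μ t) ∧ (∀ x, fderiv ℝ (regPot n μ t) x =
      newtonConst n • ∫ y, fderiv ℝ (kern (1 - (n : ℝ) / 2) t) (x - y) ∂μ) ∧
      ∀ x, lap (regPot n μ t) x = - regDens n μ t x := by
  have hn' : (3 : ℝ) ≤ n := by exact_mod_cast hn
  set p : ℝ := 1 - (n : ℝ) / 2 with hpdef
  have hp : p ≤ 0 := by rw [hpdef]; linarith
  have hk : ContDiff ℝ ⊤ (kern p t : V n → ℝ) := contDiff_kern ht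
  have hk2 : ContDiff ℝ 2 (kern p t : V n → ℝ) := hk.of_le le_top
  have hk' : ContDiff ℝ 1 (fderiv ℝ (kern p t : V n → ℝ)) := hk2.fderiv_right (by norm_num)
  have hk'' : Continuous (fderiv ℝ (fderiv ℝ (kern p t : V n → ℝ))) :=
    hk'.continuous_fderiv (by norm_num)
  have b0 : ∀ z : V n, ‖kern p t z‖ ≤ t ^ p := fun z => by
    rw [Real.norm_of_nonneg (kern_nonneg ht.le _)]; exact kern_le ht hp _
  have b1 : ∀ z : V n, ‖fderiv ℝ (kern p t) z‖ ≤ 2 * |p| * (√t) ^ (2 * p - 1) := fun z => by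
    rw [fderiv_kern ht]
    refine norm_fderiv_kern_formula_le (Real.sqrt_pos.2 ht) ?_ ht.le (by linarith)
    rw [Real.sq_sqrt ht.le]
    nlinarith [sq_nonneg ‖z‖]
  obtain ⟨C, b2⟩ := norm_fderiv_fderiv_kern_le (n := n) ht hp
  obtain ⟨c1, d1⟩ := contDiff_one_integral_sub μ (hk2.of_le (by norm_num)) b0 b1
  obtain ⟨c2, d2⟩ := contDiff_one_integral_sub μ hk' b1 b2
  set I : V n → ℝ := fun x => ∫ y, kern p t (x - y) ∂μ with hI
  have hreg : regPot n μ t = fun x => newtonConst n * I x := rfl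
  have hI2 : ContDiff ℝ 2 I := by
    rw [show (2 : WithTop ℕ∞) = 1 + 1 by norm_num, contDiff_succ_iff_fderiv]
    refine ⟨c1.differentiable (by norm_num), by simp, ?_⟩
    rw [d1]
    exact c2
  have hfd : fderiv ℝ (regPot n μ t) = fun x => newtonConst n • fderiv ℝ I x := by
    rw [hreg]
    funext x
    exact fderiv_const_mul (hI2.differentiable (by norm_num) x) _
  refine ⟨by rw [hreg]; exact contDiff_const.mul hI2, fun x => by rw [hfd, d1], fun x => ?_⟩
  have int2 : Integrable (fun y => fderiv ℝ (fderiv ℝ (kern p t : V n → ℝ)) (x - y)) μ :=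
    Integrable.of_bound
      (by fun_prop : Continuous fun y => fderiv ℝ (fderiv ℝ (kern p t : V n → ℝ)) (x - y)).aestronglyMeasurable
      C (ae_of_all _ fun y => b2 _)
  have hlap : lap (regPot n μ t) x = newtonConst n * ∫ y, lap (kern p t) (x - y) ∂μ := by
    unfold lap
    rw [integral_finsetSum, Finset.mul_sum]
    · refine Finset.sum_congr rfl fun i _ => ?_
      rw [hfd, fderiv_fun_const_smul, d1, d2]
      · simp only [smul_apply, smul_eq_mul]
        rw [ContinuousLinearMap.integral_apply int2,
          ContinuousLinearMap.integral_apply (int2.apply_continuousLinearMap _)]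
      · rw [d1]
        exact c2.differentiable (by norm_num) x
    · exact fun i _ => (int2.apply_continuousLinearMap _).apply_continuousLinearMap _
  rw [hlap, regDens, ← integral_const_mul, ← integral_neg]
  refine integral_congr_ae (ae_of_all _ fun y => ?_)
  simp only
  rw [lap_kern ht, newtonConst, show p - 2 = -1 - (n : ℝ) / 2 by rw [hpdef]; ring,
    show (n : ℝ) + 2 * (p - 1) = 0 by rw [hpdef]; ring]
  have := (volume_ball_pos (n := n)).ne'
  have h2 : (n : ℝ) - 2 ≠ 0 := by linarith
  have h3 : (n : ℝ) ≠ 0 := by linarith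
  rw [hpdef]
  field_simp
  ring

lemma continuous_regDens (ht : 0 < t) : Continuous (regDens n μ t) := by
  have hc : Continuous (kern (-1 - (n : ℝ) / 2) t : V n → ℝ) := (contDiff_kern ht).continuous
  have hω := volume_ball_pos (n := n)
  refine continuous_of_dominated
    (bound := fun _ => ((volume (Metric.ball (0 : V n) 1)).toReal)⁻¹ * t
      * t ^ (-1 - (n : ℝ) / 2)) (fun x => ?_)
    (fun x => ae_of_all _ fun y => ?_) (integrable_const _) (ae_of_all _ fun y => ?_)
  · exact Continuous.aestronglyMeasurable (by fun_prop)
  · have := kern_nonneg (n := n) (p := -1 - (n : ℝ) / 2) ht.le (x - y)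
    rw [Real.norm_of_nonneg (by positivity)]
    gcongr
    exact kern_le ht (by linarith [Nat.cast_nonneg (α := ℝ) n]) _
  · fun_prop

lemma regDens_pos (ht : 0 < t) (hμ : μ ≠ 0) (x : V n) : 0 < regDens n μ t x := by
  have hω := volume_ball_pos (n := n)
  have hpos : ∀ y, 0 < ((volume (Metric.ball (0 : V n) 1)).toReal)⁻¹ * t
      * kern (-1 - (n : ℝ) / 2) t (x - y) := fun y => by
    have := kern_pos (n := n) (p := -1 - (n : ℝ) / 2) ht (x - y)
    positivity
  refine (integral_pos_iff_support_of_nonneg (fun y => (hpos y).le)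
    ((integrable_kern_sub μ ht (by linarith [Nat.cast_nonneg (α := ℝ) n]) x).const_mul _)).2 ?_
  rw [Function.support_eq_univ fun y => (hpos y).ne']
  exact Measure.measure_univ_pos.2 hμ

lemma regPot_pos (hn : 3 ≤ n) (ht : 0 < t) (hμ : μ ≠ 0) (x : V n) : 0 < regPot n μ t x := by
  have hn' : (3 : ℝ) ≤ n := by exact_mod_cast hn
  refine mul_pos (newtonConst_pos hn) ?_
  refine (integral_pos_iff_support_of_nonneg (fun y => kern_nonneg ht.le _)
    (integrable_kern_sub μ ht (by linarith) x)).2 ?_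
  rw [Function.support_eq_univ fun y => (kern_pos ht _).ne']
  exact Measure.measure_univ_pos.2 hμ

lemma regPot_anti (hn : 3 ≤ n) {s : ℝ} (hs : 0 < s) (hst : s ≤ t) (x : V n) :
    regPot n μ t x ≤ regPot n μ s x := by
  have hn' : (3 : ℝ) ≤ n := by exact_mod_cast hn
  refine mul_le_mul_of_nonneg_left ?_ (newtonConst_pos hn).le
  refine integral_mono (integrable_kern_sub μ (hs.trans_le hst) (by linarith) x)
    (integrable_kern_sub μ hs (by linarith) x) fun y => ?_
  exact Real.rpow_le_rpow_of_nonpos (by positivity) (by linarith) (by linarith)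

end RegPot

/-- The mollifier `ω⁻¹ t (‖z‖² + t) ^ (-1 - n/2)`. -/
def moll {n : ℕ} (t : ℝ) (z : V n) : ℝ :=
  ((volume (Metric.ball (0 : V n) 1)).toReal)⁻¹ * t * kern (-1 - (n : ℝ) / 2) t z

section Moll

variable {n : ℕ} {t : ℝ}

lemma moll_nonneg (ht : 0 ≤ t) (z : V n) : 0 ≤ moll t z := by
  have := kern_nonneg (p := -1 - (n : ℝ) / 2) ht z
  unfold moll
  positivity

lemma continuous_moll (ht : 0 < t) : Continuous (moll t : V n → ℝ) :=
  continuous_const.mul (contDiff_kern ht).continuous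

lemma moll_le (ht : 0 < t) (z : V n) :
    moll t z ≤ ((volume (Metric.ball (0 : V n) 1)).toReal)⁻¹ * t * t ^ (-1 - (n : ℝ) / 2) := by
  unfold moll
  gcongr
  exact kern_le ht (by linarith [Nat.cast_nonneg (α := ℝ) n]) z

lemma integral_moll (hn : 3 ≤ n) (ht : 0 < t) : ∫ z : V n, moll t z = 1 := by
  have hn' : (3 : ℝ) ≤ n := by exact_mod_cast hn
  have hω := volume_ball_pos (n := n)
  have : Nonempty (Fin n) := ⟨⟨0, by omega⟩⟩
  set ω := (volume (Metric.ball (0 : V n) 1)).toReal with hωd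
  have hr := integral_fun_norm_addHaar (volume : Measure (V n))
    (fun r : ℝ => ω⁻¹ * t * (r ^ 2 + t) ^ (-1 - (n : ℝ) / 2))
  have hG : ∀ x ∈ Set.Ici (0 : ℝ), HasDerivAt
      (fun r : ℝ => ω⁻¹ * (n : ℝ)⁻¹ * (r ^ n * (r ^ 2 + t) ^ (-(n : ℝ) / 2)))
      (x ^ (n - 1) • (ω⁻¹ * t * (x ^ 2 + t) ^ (-1 - (n : ℝ) / 2))) x := by
    intro x _
    have hq : 0 < x ^ 2 + t := by positivity
    have h1 : HasDerivAt (fun r : ℝ => r ^ 2 + t) (2 * x) x := by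
      simpa using (hasDerivAt_pow 2 x).add_const t
    have h2 := h1.rpow_const (p := -(n : ℝ) / 2) (Or.inl hq.ne')
    have h3 := ((hasDerivAt_pow n x).mul h2).const_mul (ω⁻¹ * (n : ℝ)⁻¹)
    convert! h3 using 1
    have e1 : (x ^ 2 + t) ^ (-(n : ℝ) / 2)
        = (x ^ 2 + t) * (x ^ 2 + t) ^ (-1 - (n : ℝ) / 2) := by
      rw [show -(n : ℝ) / 2 = 1 + (-1 - (n : ℝ) / 2) by ring, Real.rpow_add hq, Real.rpow_one]
    have e2 : x ^ n = x * x ^ (n - 1) := by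
      rw [← pow_succ']; congr 1; omega
    rw [show -(n : ℝ) / 2 - 1 = -1 - (n : ℝ) / 2 by ring, e1, e2, smul_eq_mul]
    field_simp
    ring
  have hlim : Tendsto (fun r : ℝ => ω⁻¹ * (n : ℝ)⁻¹ * (r ^ n * (r ^ 2 + t) ^ (-(n : ℝ) / 2)))
      atTop (𝓝 (ω⁻¹ * (n : ℝ)⁻¹ * 1)) := by
    refine Tendsto.const_mul _ ?_
    have h0 : Tendsto (fun r : ℝ => (1 + t * (r ^ 2)⁻¹) ^ (-(n : ℝ) / 2)) atTop (𝓝 1) := by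
      have h1 : Tendsto (fun r : ℝ => 1 + t * (r ^ 2)⁻¹) atTop (𝓝 (1 + t * 0)) :=
        tendsto_const_nhds.add
          ((tendsto_inv_atTop_zero.comp (tendsto_pow_atTop two_ne_zero)).const_mul t)
      have h2 := h1.rpow_const (p := -(n : ℝ) / 2) (Or.inl (by simp))
      simpa using h2
    refine h0.congr' ?_
    filter_upwards [eventually_gt_atTop 0] with r hr
    have e : r ^ 2 + t = r ^ 2 * (1 + t * (r ^ 2)⁻¹) := by field_simp
    rw [e, Real.mul_rpow (by positivity) (by positivity), ← mul_assoc]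
    have : r ^ n * (r ^ 2) ^ (-(n : ℝ) / 2) = 1 := by
      rw [← Real.rpow_natCast r 2, ← Real.rpow_mul hr.le, ← Real.rpow_natCast r n,
        ← Real.rpow_add hr]
      convert Real.rpow_zero r using 2
      push_cast; ring
    rw [this, one_mul]
  have hint := integral_Ioi_of_hasDerivAt_of_nonneg' hG (fun x (hx : 0 < x) => by
    have : 0 < x ^ 2 + t := by positivity
    positivity) hlim
  have hfin : Module.finrank ℝ (V n) = n := by simp
  rw [hfin, hint] at hr
  have e : ∀ z : V n, moll t z = ω⁻¹ * t * (‖z‖ ^ 2 + t) ^ (-1 - (n : ℝ) / 2) := fun z => rfl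
  simp only [e]
  rw [hr]
  simp only [Measure.real, smul_eq_mul, nsmul_eq_mul]
  rw [zero_pow (by omega)]
  rw [← hωd]
  field_simp
  simp

lemma integrable_moll (hn : 3 ≤ n) (ht : 0 < t) : Integrable (moll t : V n → ℝ) :=
  integrable_of_integral_eq_one (integral_moll hn ht)

lemma moll_scale {c : ℝ} (hc : 0 < c) (z : V n) :
    moll ((c ^ 2)⁻¹) z = c ^ n * moll 1 (c • z) := by
  have e : ‖c • z‖ ^ 2 + 1 = c ^ 2 * (‖z‖ ^ 2 + (c ^ 2)⁻¹) := by
    rw [norm_smul, Real.norm_of_nonneg hc.le]; field_simp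
  unfold moll kern
  rw [e, Real.mul_rpow (by positivity) (by positivity)]
  have : (c ^ 2)⁻¹ = c ^ n * (c ^ 2) ^ (-1 - (n : ℝ) / 2) := by
    rw [← Real.rpow_natCast c 2, ← Real.rpow_mul hc.le, ← Real.rpow_natCast c n,
      ← Real.rpow_add hc, ← Real.rpow_neg hc.le]
    congr 1; push_cast; ring
  conv_lhs => rw [mul_assoc, mul_comm (c ^ 2)⁻¹]
  nth_rw 2 [this]
  ring

lemma tendsto_integral_mul_moll (hn : 3 ≤ n) {f : V n → ℝ} (hf : Continuous f)
    (hs : HasCompactSupport f) (y : V n) :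
    Tendsto (fun c : ℝ => ∫ x, f x * moll ((c ^ 2)⁻¹) (x - y)) atTop (𝓝 (f y)) := by
  have hdec : Tendsto (fun x : V n => ‖x‖ ^ Module.finrank ℝ (V n) * moll 1 x)
      (Bornology.cobounded (V n)) (𝓝 0) := by
    have hfin : Module.finrank ℝ (V n) = n := by simp
    rw [hfin]
    set ω := (volume (Metric.ball (0 : V n) 1)).toReal
    have h1 : Tendsto (fun x : V n => ω⁻¹ * (‖x‖ ^ 2 + 1)⁻¹) (Bornology.cobounded (V n))
        (𝓝 (ω⁻¹ * 0)) := by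
      refine Tendsto.const_mul _ (tendsto_inv_atTop_zero.comp ?_)
      exact tendsto_atTop_add_const_right _ _
        ((tendsto_pow_atTop two_ne_zero).comp tendsto_norm_cobounded_atTop)
    rw [mul_zero] at h1
    refine squeeze_zero (fun x => mul_nonneg (by positivity) (moll_nonneg zero_le_one x))
      (fun x => ?_) h1
    have hq : 0 < ‖x‖ ^ 2 + 1 := by positivity
    have h2 : ‖x‖ ^ n ≤ (‖x‖ ^ 2 + 1) ^ ((n : ℝ) / 2) := by
      calc ‖x‖ ^ n = (‖x‖ ^ 2) ^ ((n : ℝ) / 2) := by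
            rw [← Real.rpow_natCast ‖x‖ 2, ← Real.rpow_mul (norm_nonneg _), ← Real.rpow_natCast]
            congr 1; push_cast; ring
        _ ≤ _ := by gcongr; linarith
    calc ‖x‖ ^ n * moll 1 x
        ≤ (‖x‖ ^ 2 + 1) ^ ((n : ℝ) / 2) * moll 1 x := by
          gcongr
          exact moll_nonneg zero_le_one x
      _ = ω⁻¹ * ((‖x‖ ^ 2 + 1) ^ ((n : ℝ) / 2) * (‖x‖ ^ 2 + 1) ^ (-1 - (n : ℝ) / 2)) := by
          unfold moll kern; ring
      _ = ω⁻¹ * (‖x‖ ^ 2 + 1)⁻¹ := by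
          rw [← Real.rpow_add hq, show (n : ℝ) / 2 + (-1 - (n : ℝ) / 2) = -1 by ring,
            Real.rpow_neg_one]
  have h := tendsto_integral_comp_smul_smul_of_integrable' (μ := (volume : Measure (V n)))
    (moll_nonneg zero_le_one) (integral_moll hn one_pos) hdec
    (hf.integrable_of_hasCompactSupport hs) (hf.continuousAt (x := y))
  refine h.congr' ?_
  filter_upwards [eventually_gt_atTop 0] with c hc
  refine integral_congr_ae (ae_of_all _ fun x => ?_)
  have hfin : Module.finrank ℝ (V n) = n := by simp
  simp only [smul_eq_mul]
  rw [moll_scale hc, hfin, mul_comm]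
  congr 2
  unfold moll kern
  rw [norm_smul, norm_smul, norm_sub_rev]

/-- The mollified measures converge weakly to the measure. -/
lemma tendsto_integral_mul_regDens (hn : 3 ≤ n) (μ : Measure (V n)) [IsFiniteMeasure μ]
    {f : V n → ℝ} (hf : Continuous f) (hs : HasCompactSupport f) :
    Tendsto (fun c : ℝ => ∫ x, f x * regDens n μ ((c ^ 2)⁻¹) x) atTop (𝓝 (∫ y, f y ∂μ)) := by
  have hfi : Integrable f := hf.integrable_of_hasCompactSupport hs
  obtain ⟨C, hC⟩ := hf.bounded_above_of_compact_support hs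
  have hC0 : 0 ≤ C := (norm_nonneg _).trans (hC 0)
  have key : ∀ c : ℝ, 0 < c → ∫ x, f x * regDens n μ ((c ^ 2)⁻¹) x
      = ∫ y, (∫ x, f x * moll ((c ^ 2)⁻¹) (x - y)) ∂μ := by
    intro c hc
    have ht : 0 < (c ^ 2)⁻¹ := by positivity
    rw [← integral_integral_swap]
    · refine integral_congr_ae (ae_of_all _ fun x => ?_)
      simp only
      rw [integral_const_mul]
      rfl
    · have h1 : Integrable (fun z : V n × V n => f z.1) (volume.prod μ) := hfi.comp_fst μ
      have hm := continuous_moll (n := n) ht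
      refine h1.mul_bdd (c := ((volume (Metric.ball (0 : V n) 1)).toReal)⁻¹ * (c ^ 2)⁻¹
        * ((c ^ 2)⁻¹) ^ (-1 - (n : ℝ) / 2)) ?_ (ae_of_all _ fun z => ?_)
      · exact (by fun_prop : Continuous fun z : V n × V n =>
          moll ((c ^ 2)⁻¹) (z.1 - z.2)).aestronglyMeasurable
      · rw [Real.norm_of_nonneg (moll_nonneg ht.le _)]
        exact moll_le ht _
  have h : Tendsto (fun c : ℝ => ∫ y, (∫ x, f x * moll ((c ^ 2)⁻¹) (x - y)) ∂μ) atTop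
      (𝓝 (∫ y, f y ∂μ)) := by
    refine tendsto_integral_filter_of_dominated_convergence (fun _ => C) ?_ ?_
      (integrable_const C) (ae_of_all _ fun y => tendsto_integral_mul_moll hn hf hs y)
    · filter_upwards [eventually_gt_atTop 0] with c hc
      have hm := continuous_moll (n := n) (t := (c ^ 2)⁻¹) (by positivity)
      refine StronglyMeasurable.aestronglyMeasurable ?_
      refine StronglyMeasurable.integral_prod_right (f := fun y x : V n =>
        f x * moll ((c ^ 2)⁻¹) (x - y)) ?_
      exact Continuous.stronglyMeasurable (by fun_prop)
    · filter_upwards [eventually_gt_atTop 0] with c hc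
      refine ae_of_all _ fun y => ?_
      have ht : 0 < (c ^ 2)⁻¹ := by positivity
      have hmi : Integrable (fun x : V n => moll ((c ^ 2)⁻¹) (x - y)) :=
        (integrable_moll hn ht).comp_sub_right y
      calc ‖∫ x, f x * moll ((c ^ 2)⁻¹) (x - y)‖
          ≤ ∫ x, C * moll ((c ^ 2)⁻¹) (x - y) := by
            refine norm_integral_le_of_norm_le (hmi.const_mul C) (ae_of_all _ fun x => ?_)
            rw [norm_mul, Real.norm_of_nonneg (moll_nonneg ht.le (x - y))]
            exact mul_le_mul_of_nonneg_right (hC x) (moll_nonneg ht.le _)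
        _ = C := by
            rw [integral_const_mul, integral_sub_right_eq_self (moll ((c ^ 2)⁻¹)),
              integral_moll hn ht, mul_one]
  refine h.congr' ?_
  filter_upwards [eventually_gt_atTop 0] with c hc
  exact (key c hc).symm

end Moll

/-- The regularized Newtonian kernel with values in `[0, ∞]`. -/
def ekern {n : ℕ} (t : ℝ) (z : V n) : ENNReal :=
  ENNReal.ofReal (‖z‖ ^ 2 + t) ^ (1 - (n : ℝ) / 2)

/-- A sequence of regularization parameters decreasing to zero. -/
def regParam (j : ℕ) : ℝ := (((j : ℝ) + 1) ^ 2)⁻¹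

lemma regParam_pos (j : ℕ) : 0 < regParam j := by
  unfold regParam; positivity

lemma regParam_anti : Antitone regParam := fun i j h => by
  unfold regParam
  gcongr

lemma tendsto_regParam : Tendsto regParam atTop (𝓝 0) := by
  refine tendsto_inv_atTop_zero.comp ((tendsto_pow_atTop two_ne_zero).comp ?_)
  exact tendsto_atTop_add_const_right _ _ tendsto_natCast_atTop_atTop

section Finite

variable {n : ℕ} {t : ℝ}

lemma ekern_eq {z : V n} (hz : 0 < ‖z‖ ^ 2 + t) :
    ekern t z = ENNReal.ofReal (kern (1 - (n : ℝ) / 2) t z) :=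
  ENNReal.ofReal_rpow_of_pos hz

lemma ekern_zero_zero (hn : 3 ≤ n) : ekern 0 (0 : V n) = ⊤ := by
  have hn' : (3 : ℝ) ≤ n := by exact_mod_cast hn
  unfold ekern
  simp only [norm_zero, ne_eq, OfNat.ofNat_ne_zero, not_false_eq_true, zero_pow, add_zero,
    ENNReal.ofReal_zero]
  exact ENNReal.zero_rpow_of_neg (by linarith)

lemma ofReal_kern_le_ekern (hn : 3 ≤ n) (ht : 0 ≤ t) (z : V n) :
    ENNReal.ofReal (kern (1 - (n : ℝ) / 2) t z) ≤ ekern 0 z := by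
  have hn' : (3 : ℝ) ≤ n := by exact_mod_cast hn
  rcases eq_or_ne z 0 with rfl | hz
  · rw [ekern_zero_zero hn]; exact le_top
  · have : 0 < ‖z‖ := norm_pos_iff.2 hz
    rw [ekern_eq (by positivity)]
    exact ENNReal.ofReal_le_ofReal
      (Real.rpow_le_rpow_of_nonpos (by positivity) (by linarith) (by linarith))

lemma measurable_ekern : Measurable (ekern t : V n → ENNReal) := by
  unfold ekern
  fun_prop

lemma tendsto_ekern (z : V n) : Tendsto (fun j => ekern (regParam j) z) atTop (𝓝 (ekern 0 z)) := by
  unfold ekern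
  refine (ENNReal.continuous_rpow_const.tendsto _).comp
    ((ENNReal.continuous_ofReal.tendsto _).comp ?_)
  exact tendsto_const_nhds.add tendsto_regParam

lemma lintegral_ekern_ball (hn : 3 ≤ n) :
    ∫⁻ z in Metric.ball (0 : V n) 1, ekern 0 z < ⊤ := by
  have hn' : (3 : ℝ) ≤ n := by exact_mod_cast hn
  have : Nonempty (Fin n) := ⟨⟨0, by omega⟩⟩
  have hfin : Module.finrank ℝ (V n) = n := by simp
  have h : IntegrableOn (fun z : V n => kern (1 - (n : ℝ) / 2) 0 z) (Metric.ball 0 1) := by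
    have := integrableOn_fun_norm_addHaar (volume : Measure (V n)) (r := 1)
      (f := fun r : ℝ => (r ^ 2 + 0) ^ (1 - (n : ℝ) / 2))
    refine this.2 ?_
    rw [hfin]
    refine Integrable.mono' (g := fun _ => (1 : ℝ)) ?_ ?_ ?_
    · exact integrableOn_const (by simp)
    · exact Measurable.aestronglyMeasurable (by fun_prop)
    · refine (ae_restrict_iff' measurableSet_Ioo).2 (ae_of_all _ fun r hr => ?_)
      have hr0 : 0 < r := hr.1
      rw [add_zero, Real.norm_of_nonneg (by positivity), smul_eq_mul]
      have : r ^ (n - 1) * (r ^ 2) ^ (1 - (n : ℝ) / 2) = r := by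
        rw [← Real.rpow_natCast r 2, ← Real.rpow_mul hr0.le, ← Real.rpow_natCast r (n - 1),
          ← Real.rpow_add hr0]
        convert Real.rpow_one r using 2
        rw [Nat.cast_sub (by omega)]
        push_cast; ring
      rw [this]; exact hr.2.le
  have h2 := h.lintegral_lt_top
  refine lt_of_eq_of_lt ?_ h2
  refine lintegral_congr_ae (ae_restrict_of_ae ?_)
  have h0 : ∀ᵐ z : V n, z ≠ 0 := by
    simp [ae_iff]
  filter_upwards [h0] with z hz
  have : 0 < ‖z‖ := norm_pos_iff.2 hz
  exact ekern_eq (by positivity)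

lemma integrable_kern_zero_sub (μ : Measure (V n)) (hn : 3 ≤ n) {x : V n}
    (hx : ∫⁻ y, ekern 0 (x - y) ∂μ < ⊤) :
    Integrable (fun y => kern (1 - (n : ℝ) / 2) 0 (x - y)) μ := by
  refine ⟨Measurable.aestronglyMeasurable (by unfold kern; fun_prop), ?_⟩
  refine lt_of_le_of_lt (lintegral_mono fun y => ?_) hx
  rw [Real.enorm_eq_ofReal (kern_nonneg le_rfl _)]
  exact ofReal_kern_le_ekern hn le_rfl _

lemma ae_ne_of_lintegral_ekern_lt_top (μ : Measure (V n)) (hn : 3 ≤ n) {x : V n}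
    (hx : ∫⁻ y, ekern 0 (x - y) ∂μ < ⊤) : ∀ᵐ y ∂μ, y ≠ x := by
  have h := ae_lt_top (f := fun y => ekern 0 (x - y)) (measurable_ekern.comp (by fun_prop)) hx.ne
  filter_upwards [h] with y hy hyx
  rw [hyx, sub_self, ekern_zero_zero hn] at hy
  exact lt_irrefl _ hy

variable (μ : Measure (V n)) [IsFiniteMeasure μ]

lemma ae_lintegral_ekern_lt_top (hn : 3 ≤ n) :
    ∀ᵐ x : V n, ∫⁻ y, ekern 0 (x - y) ∂μ < ⊤ := by
  have hn' : (3 : ℝ) ≤ n := by exact_mod_cast hn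
  set K : V n → ENNReal := (Metric.ball (0 : V n) 1).indicator (ekern 0) with hK
  have hKm : Measurable K := measurable_ekern.indicator measurableSet_ball
  have hKi : ∫⁻ z, K z < ⊤ := by
    rw [hK, lintegral_indicator measurableSet_ball]
    exact lintegral_ekern_ball hn
  have hle : ∀ z : V n, ekern 0 z ≤ K z + 1 := by
    intro z
    by_cases hz : z ∈ Metric.ball (0 : V n) 1
    · rw [hK, Set.indicator_of_mem hz]; exact le_self_add
    · have hz1 : 1 ≤ ‖z‖ := by simpa using hz
      refine le_trans ?_ le_add_self
      rw [ekern_eq (by positivity)]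
      refine ENNReal.ofReal_le_one.2 ?_
      exact Real.rpow_le_one_of_one_le_of_nonpos (by nlinarith) (by linarith)
  have hm : Measurable fun z : V n × V n => K (z.1 - z.2) := hKm.comp (by fun_prop)
  have hswap : ∫⁻ x, ∫⁻ y, K (x - y) ∂μ < ⊤ := by
    rw [lintegral_lintegral_swap hm.aemeasurable]
    simp_rw [lintegral_sub_right_eq_self K, lintegral_const]
    exact ENNReal.mul_lt_top hKi (measure_lt_top μ _)
  have hae := ae_lt_top (Measurable.lintegral_prod_right' hm) hswap.ne
  filter_upwards [hae] with x hx
  calc ∫⁻ y, ekern 0 (x - y) ∂μ ≤ ∫⁻ y, (K (x - y) + 1) ∂μ := lintegral_mono fun y => hle _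
    _ = ∫⁻ y, K (x - y) ∂μ + μ Set.univ := by
        rw [lintegral_add_right _ measurable_const]; simp
    _ < ⊤ := ENNReal.add_lt_top.2 ⟨hx, measure_lt_top μ _⟩

lemma regPot_le_Ppot_of_lt_top (hn : 3 ≤ n) (ht : 0 < t) {x : V n}
    (hx : ∫⁻ y, ekern 0 (x - y) ∂μ < ⊤) : regPot n μ t x ≤ Ppot n μ x := by
  have hn' : (3 : ℝ) ≤ n := by exact_mod_cast hn
  rw [← regPot_zero]
  refine mul_le_mul_of_nonneg_left ?_ (newtonConst_pos hn).le
  refine integral_mono_ae (integrable_kern_sub μ ht (by linarith) x)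
    (integrable_kern_zero_sub μ hn hx) ?_
  filter_upwards [ae_ne_of_lintegral_ekern_lt_top μ hn hx] with y hy
  have : 0 < ‖x - y‖ := norm_pos_iff.2 (sub_ne_zero.2 hy.symm)
  exact Real.rpow_le_rpow_of_nonpos (by positivity) (by linarith) (by linarith)

lemma regPot_le_one (hn : 3 ≤ n) (ht : 0 < t) (hle : ∀ x, Ppot n μ x ≤ 1) (x : V n) :
    regPot n μ t x ≤ 1 := by
  have hd : Dense {x : V n | regPot n μ t x ≤ 1} := Measure.dense_of_ae (μ := volume) <| by
    filter_upwards [ae_lintegral_ekern_lt_top μ hn] with x hx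
    exact (regPot_le_Ppot_of_lt_top μ hn ht hx).trans (hle x)
  have hc : IsClosed {x : V n | regPot n μ t x ≤ 1} :=
    isClosed_le (contDiff_regPot μ hn ht).1.continuous continuous_const
  exact hc.closure_subset (hd x)

/-- If the potential is at most one (where it is finite), then it is finite everywhere. -/
lemma lintegral_ekern_lt_top (hn : 3 ≤ n) (hle : ∀ x, Ppot n μ x ≤ 1) (x : V n) :
    ∫⁻ y, ekern 0 (x - y) ∂μ < ⊤ := by
  have hn' : (3 : ℝ) ≤ n := by exact_mod_cast hn
  have hc := newtonConst_pos hn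
  have hj : ∀ j, ∫⁻ y, ekern (regParam j) (x - y) ∂μ ≤ ENNReal.ofReal (newtonConst n)⁻¹ := by
    intro j
    have ht := regParam_pos j
    have e : ∀ y, ekern (regParam j) (x - y)
        = ENNReal.ofReal (kern (1 - (n : ℝ) / 2) (regParam j) (x - y)) := fun y =>
      ekern_eq (by positivity)
    simp_rw [e]
    rw [← ofReal_integral_eq_lintegral_ofReal (integrable_kern_sub μ ht (by linarith) x)
      (ae_of_all _ fun y => kern_nonneg ht.le _)]
    refine ENNReal.ofReal_le_ofReal ?_
    have h1 : newtonConst n * _ ≤ 1 := regPot_le_one μ hn ht hle x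
    rw [← one_div, le_div_iff₀ hc, mul_comm]
    exact h1
  have hF := lintegral_liminf_le (μ := μ) (u := atTop)
    (f := fun j y => ekern (regParam j) (x - y)) fun j => measurable_ekern.comp (by fun_prop)
  have e : ∀ y, liminf (fun j => ekern (regParam j) (x - y)) atTop = ekern 0 (x - y) :=
    fun y => (tendsto_ekern _).liminf_eq
  simp_rw [e] at hF
  refine (hF.trans (?_ : _ ≤ ENNReal.ofReal (newtonConst n)⁻¹)).trans_lt ENNReal.ofReal_lt_top
  exact liminf_le_of_le (by isBoundedDefault) fun b hb =>
    let ⟨j, hj'⟩ := hb.exists; hj'.trans (hj j)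

lemma regPot_le_Ppot (hn : 3 ≤ n) (ht : 0 < t) (hle : ∀ x, Ppot n μ x ≤ 1) (x : V n) :
    regPot n μ t x ≤ Ppot n μ x :=
  regPot_le_Ppot_of_lt_top μ hn ht (lintegral_ekern_lt_top μ hn hle x)

lemma tendsto_regPot (hn : 3 ≤ n) (hle : ∀ x, Ppot n μ x ≤ 1) (x : V n) :
    Tendsto (fun j => regPot n μ (regParam j) x) atTop (𝓝 (Ppot n μ x)) := by
  have hn' : (3 : ℝ) ≤ n := by exact_mod_cast hn
  have hx := lintegral_ekern_lt_top μ hn hle x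
  rw [← regPot_zero]
  refine Tendsto.const_mul _ ?_
  have hne := ae_ne_of_lintegral_ekern_lt_top μ hn hx
  refine tendsto_integral_of_dominated_convergence _ (fun j => ?_)
    (integrable_kern_zero_sub μ hn hx) (fun j => ?_) ?_
  · exact Measurable.aestronglyMeasurable (by unfold kern; fun_prop)
  · filter_upwards [hne] with y hy
    have : 0 < ‖x - y‖ := norm_pos_iff.2 (sub_ne_zero.2 hy.symm)
    have h0 := regParam_pos j
    rw [Real.norm_of_nonneg (kern_nonneg h0.le _)]
    exact Real.rpow_le_rpow_of_nonpos (by positivity) (by linarith) (by linarith)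
  · filter_upwards [hne] with y hy
    have : 0 < ‖x - y‖ := norm_pos_iff.2 (sub_ne_zero.2 hy.symm)
    unfold kern
    exact (tendsto_const_nhds.add tendsto_regParam).rpow_const (Or.inl (by positivity))

lemma measurable_Ppot (hn : 3 ≤ n) (hle : ∀ x, Ppot n μ x ≤ 1) : Measurable (Ppot n μ) :=
  measurable_of_tendsto_metrizable
    (fun j => (contDiff_regPot μ hn (regParam_pos j)).1.continuous.measurable)
    (tendsto_pi_nhds.2 (tendsto_regPot μ hn hle))

/-! ### Behaviour off the support -/

/-- Off the support the potential is differentiable and its gradient is the limit of the gradients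
of the regularized potentials. -/
lemma hasFDerivAt_Ppot (hn : 3 ≤ n) (hle : ∀ x, Ppot n μ x ≤ 1) {e : Set (V n)}
    (he : IsClosed e) (hsupp : μ eᶜ = 0) {x : V n} (hx : x ∉ e) :
    DifferentiableAt ℝ (Ppot n μ) x ∧
      Tendsto (fun j => fderiv ℝ (regPot n μ (regParam j)) x) atTop
        (𝓝 (fderiv ℝ (Ppot n μ) x)) := by
  have hn' : (3 : ℝ) ≤ n := by exact_mod_cast hn
  set p : ℝ := 1 - (n : ℝ) / 2 with hp
  obtain ⟨r, hr, hball⟩ : ∃ r > 0, Metric.ball x (2 * r) ⊆ eᶜ := by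
    obtain ⟨ε, hε, h⟩ := Metric.isOpen_iff.1 he.isOpen_compl x hx
    exact ⟨ε / 2, by positivity, by rwa [mul_div_cancel₀ _ two_ne_zero]⟩
  have hae : ∀ᵐ y ∂μ, y ∈ e := by rw [ae_iff]; exact hsupp
  have hfar : ∀ᵐ y ∂μ, ∀ z ∈ Metric.ball x r, r ≤ ‖z - y‖ := by
    filter_upwards [hae] with y hy z hz
    by_contra hcon
    push Not at hcon
    refine hball (a := y) ?_ hy
    rw [Metric.mem_ball, dist_eq_norm] at hz ⊢
    calc ‖y - x‖ = ‖(z - x) - (z - y)‖ := by congr 1; abel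
      _ ≤ ‖z - x‖ + ‖z - y‖ := norm_sub_le _ _
      _ < 2 * r := by linarith
  have hD : HasFDerivAt (fun z => ∫ y, kern p 0 (z - y) ∂μ)
      (∫ y, (2 * p * kern (p - 1) 0 (x - y)) • ipL n (x - y) ∂μ) x := by
    refine hasFDerivAt_integral_of_dominated_of_fderiv_le (F := fun z y => kern p 0 (z - y))
      (F' := fun z y => (2 * p * kern (p - 1) 0 (z - y)) • ipL n (z - y))
      (bound := fun _ => 2 * |p| * r ^ (2 * p - 1))
      (Metric.ball_mem_nhds x hr) (Eventually.of_forall fun z => ?_)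
      (integrable_kern_zero_sub μ hn (lintegral_ekern_lt_top μ hn hle x)) ?_ ?_
      (integrable_const _) ?_
    · exact Measurable.aestronglyMeasurable (by unfold kern; fun_prop)
    · refine Measurable.aestronglyMeasurable ?_
      unfold kern
      have : Measurable fun y => ipL n (x - y) :=
        ((ipL n).continuous.comp (by fun_prop)).measurable
      exact Measurable.smul (f := fun y => 2 * p * (‖x - y‖ ^ 2 + 0) ^ (p - 1)) (by fun_prop) this
    · filter_upwards [hfar] with y hy z hz
      have := hy z hz
      exact norm_fderiv_kern_formula_le hr (by nlinarith) le_rfl (by linarith)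
    · filter_upwards [hfar] with y hy z hz
      have h1 := hy z hz
      have h2 : HasFDerivAt (kern p 0) _ (z - y) := hasFDerivAt_kern (by nlinarith)
      exact (hasFDerivAt_comp_sub y).2 h2
  have hP : HasFDerivAt (Ppot n μ)
      (newtonConst n • ∫ y, (2 * p * kern (p - 1) 0 (x - y)) • ipL n (x - y) ∂μ) x := by
    rw [← regPot_zero]
    exact hD.const_mul _
  refine ⟨hP.differentiableAt, ?_⟩
  rw [hP.fderiv]
  have e : ∀ j, fderiv ℝ (regPot n μ (regParam j)) x = newtonConst n •
      ∫ y, (2 * p * kern (p - 1) (regParam j) (x - y)) • ipL n (x - y) ∂μ := by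
    intro j
    rw [(contDiff_regPot μ hn (regParam_pos j)).2.1 x, fderiv_kern (regParam_pos j)]
  simp_rw [e]
  refine Tendsto.const_smul ?_ _
  refine tendsto_integral_of_dominated_convergence (fun _ => 2 * |p| * r ^ (2 * p - 1))
    (fun j => ?_) (integrable_const _) (fun j => ?_) ?_
  · refine Measurable.aestronglyMeasurable ?_
    unfold kern
    have : Measurable fun y => ipL n (x - y) :=
      ((ipL n).continuous.comp (by fun_prop)).measurable
    exact Measurable.smul (f := fun y => 2 * p * (‖x - y‖ ^ 2 + regParam j) ^ (p - 1)) (by fun_prop) this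
  · filter_upwards [hfar] with y hy
    have := hy x (Metric.mem_ball_self hr)
    have h0 := (regParam_pos j).le
    exact norm_fderiv_kern_formula_le hr (by nlinarith) h0 (by linarith)
  · filter_upwards [hfar] with y hy
    have := hy x (Metric.mem_ball_self hr)
    have h1 : 0 < ‖x - y‖ ^ 2 + 0 := by nlinarith
    refine Tendsto.smul_const (Tendsto.const_mul _ ?_) _
    unfold kern
    exact (tendsto_const_nhds.add tendsto_regParam).rpow_const (Or.inl h1.ne')

/-- The potential of a compactly supported measure vanishes at infinity. -/
lemma exists_Ppot_lt (hn : 3 ≤ n) {e : Set (V n)} (he : IsCompact e) (hsupp : μ eᶜ = 0)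
    {s : ℝ} (hs : 0 < s) : ∃ R : ℝ, 0 < R ∧ e ⊆ Metric.ball 0 R ∧
      ∀ x : V n, R ≤ ‖x‖ → Ppot n μ x < s := by
  have hn' : (3 : ℝ) ≤ n := by exact_mod_cast hn
  obtain ⟨R₀, hR₀, hsub⟩ := he.isBounded.subset_ball_lt 0 (0 : V n)
  have hae : ∀ᵐ y ∂μ, y ∈ e := by rw [ae_iff]; exact hsupp
  have hlim : Tendsto (fun d : ℝ => newtonConst n * (μ.real Set.univ * d ^ (2 - (n : ℝ)))) atTop
      (𝓝 (newtonConst n * (μ.real Set.univ * 0))) := by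
    refine Tendsto.const_mul _ (Tendsto.const_mul _ ?_)
    have := tendsto_rpow_neg_atTop (y := (n : ℝ) - 2) (by linarith)
    simpa using this
  rw [mul_zero, mul_zero] at hlim
  obtain ⟨d, hd, hd1⟩ := ((hlim.eventually_lt_const hs).and (eventually_gt_atTop 0)).exists
  refine ⟨R₀ + d, by positivity, hsub.trans (Metric.ball_subset_ball (by linarith)), ?_⟩
  intro x hx
  refine lt_of_le_of_lt ?_ hd
  refine mul_le_mul_of_nonneg_left ?_ (newtonConst_pos hn).le
  have hb : ∀ᵐ y ∂μ, ‖x - y‖ ^ (2 - (n : ℝ)) ≤ d ^ (2 - (n : ℝ)) := by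
    filter_upwards [hae] with y hy
    have h1 : ‖y‖ < R₀ := by simpa using hsub hy
    have h2 : ‖x‖ - ‖y‖ ≤ ‖x - y‖ := norm_sub_norm_le x y
    exact Real.rpow_le_rpow_of_nonpos hd1 (by linarith) (by linarith)
  calc ∫ y, ‖x - y‖ ^ (2 - (n : ℝ)) ∂μ ≤ ∫ _, d ^ (2 - (n : ℝ)) ∂μ :=
        integral_mono_of_nonneg (ae_of_all _ fun y => by positivity) (integrable_const _) hb
    _ = μ.real Set.univ * d ^ (2 - (n : ℝ)) := by simp

end Finite

section Null

variable {n : ℕ}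

lemma exists_cutoff {e : Set (V n)} (he : Bornology.IsBounded e) :
    ∃ u : V n → ℝ, IsTestR u ∧ (∀ x ∈ e, u x = 1) ∧ (∀ x, 0 ≤ u x) ∧ ∀ x, u x ≤ 1 := by
  obtain ⟨R, hR, hsub⟩ := he.subset_ball_lt 0 (0 : V n)
  let b : ContDiffBump (0 : V n) := ⟨R, R + 1, hR, by linarith⟩
  exact ⟨b, ⟨b.contDiff, b.hasCompactSupport⟩,
    fun x hx => b.one_of_mem_closedBall (Metric.ball_subset_closedBall (hsub hx)),
    fun x => b.nonneg, fun x => b.le_one⟩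

lemma exists_test_of_cap_eq_zero {k : Set (V n)} (hk : IsCompact k) (h0 : cap n k = 0) {ε : ℝ}
    (hε : 0 < ε) : ∃ u : V n → ℝ, IsTestR u ∧ (∀ x ∈ k, 1 ≤ u x) ∧
      ∫ x : V n, ‖fderiv ℝ u x‖ ^ 2 < ε := by
  obtain ⟨u, hu, hu1, -⟩ := exists_cutoff hk.isBounded
  obtain ⟨_, ⟨v, hv, hv1, rfl⟩, hlt⟩ := exists_lt_of_csInf_lt (b := ε)
    (s := {t : ℝ | ∃ u : V n → ℝ, IsTestR u ∧ (∀ x ∈ k, 1 ≤ u x) ∧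
      t = ∫ x : V n, ‖fderiv ℝ u x‖ ^ 2}) ⟨_, u, hu, fun x hx => (hu1 x hx).ge, rfl⟩ (h0.trans_lt hε)
  exact ⟨v, hv, hv1, hlt⟩

variable (μ : Measure (V n)) [IsFiniteMeasure μ] {t : ℝ}

lemma integral_sq_mul_regDens_div_le (hn : 3 ≤ n) (hμ : μ ≠ 0) (ht : 0 < t) {u : V n → ℝ}
    (hu : IsTestR u) : ∫ x, u x ^ 2 * regDens n μ t x / regPot n μ t x
      ≤ ∫ x : V n, ‖fderiv ℝ u x‖ ^ 2 := by
  obtain ⟨h1, -, h3⟩ := contDiff_regPot μ hn ht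
  have h := integral_picone_le (hu.1.of_le (by exact_mod_cast le_top)) hu.2 h1
    (regPot_pos μ hn ht hμ)
  simpa [h3] using h

lemma integrable_sq_mul_regDens_div (hn : 3 ≤ n) (hμ : μ ≠ 0) (ht : 0 < t) {u : V n → ℝ}
    (hu : IsTestR u) : Integrable fun x => u x ^ 2 * regDens n μ t x / regPot n μ t x := by
  have h1 := (contDiff_regPot μ hn ht).1.continuous
  have h2 := continuous_regDens μ ht
  have h3 := hu.1.continuous
  refine Continuous.integrable_of_hasCompactSupport ?_ ?_
  · exact (by fun_prop : Continuous fun x => u x ^ 2 * regDens n μ t x).div h1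
      fun x => (regPot_pos μ hn ht hμ x).ne'
  · refine hu.2.mono fun x hx => ?_
    contrapose! hx
    simp [Function.notMem_support.1 hx]

lemma volume_eq_zero_of_cap_eq_zero (hn : 3 ≤ n) (hμ : μ ≠ 0) {k : Set (V n)} (hk : IsCompact k)
    (h0 : cap n k = 0) : volume k = 0 := by
  set h : V n → ℝ := fun x => regDens n μ 1 x / regPot n μ 1 x with hh
  have hpos : ∀ x, 0 < h x := fun x =>
    div_pos (regDens_pos μ one_pos hμ x) (regPot_pos μ hn one_pos hμ x)
  have hc : Continuous h := (continuous_regDens μ one_pos).div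
    (contDiff_regPot μ hn one_pos).1.continuous fun x => (regPot_pos μ hn one_pos hμ x).ne'
  have hint : IntegrableOn h k := hc.continuousOn.integrableOn_compact hk
  have hle : ∫ x in k, h x ≤ 0 := by
    refine le_of_forall_pos_lt_add fun ε hε => ?_
    obtain ⟨u, hu, hu1, hlt⟩ := exists_test_of_cap_eq_zero hk h0 hε
    rw [zero_add]
    refine lt_of_le_of_lt ?_ hlt
    refine le_trans ?_ (integral_sq_mul_regDens_div_le μ hn hμ one_pos hu)
    have hi := integrable_sq_mul_regDens_div μ hn hμ one_pos hu
    calc ∫ x in k, h x ≤ ∫ x in k, u x ^ 2 * regDens n μ 1 x / regPot n μ 1 x := by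
          refine setIntegral_mono_on hint hi.integrableOn hk.measurableSet fun x hx => ?_
          rw [mul_div_assoc]
          have h1 := hu1 x hx
          exact le_mul_of_one_le_left (hpos x).le (by nlinarith)
      _ ≤ _ := setIntegral_le_integral hi (ae_of_all _ fun x => by
          have := hpos x
          change 0 ≤ u x ^ 2 * regDens n μ 1 x / regPot n μ 1 x
          rw [mul_div_assoc]
          positivity)
  by_contra hne
  refine hle.not_gt ((setIntegral_pos_iff_support_of_nonneg_ae
    (ae_of_all _ fun x => (hpos x).le) hint).2 ?_)
  rw [Function.support_eq_univ fun x => (hpos x).ne', Set.univ_inter]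
  exact pos_iff_ne_zero.2 hne

lemma integral_sq_le (hn : 3 ≤ n) (hμ : μ ≠ 0) (hle : ∀ x, Ppot n μ x ≤ 1) {u : V n → ℝ}
    (hu : IsTestR u) : ∫ x, u x ^ 2 ∂μ ≤ ∫ x : V n, ‖fderiv ℝ u x‖ ^ 2 := by
  have hc := hu.1.continuous
  have hs : HasCompactSupport fun x => u x ^ 2 := hu.2.mono fun x hx => by
    contrapose! hx
    simp [Function.notMem_support.1 hx]
  refine le_of_tendsto (tendsto_integral_mul_regDens hn μ (hc.pow 2) hs) ?_
  filter_upwards [eventually_gt_atTop 0] with c hc0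
  have ht : 0 < (c ^ 2)⁻¹ := by positivity
  refine le_trans ?_ (integral_sq_mul_regDens_div_le μ hn hμ ht hu)
  refine integral_mono ?_ (integrable_sq_mul_regDens_div μ hn hμ ht hu) fun x => ?_
  · exact ((hc.pow 2).mul (continuous_regDens μ ht)).integrable_of_hasCompactSupport hs.mul_right
  · have h1 := regDens_pos μ ht hμ x
    have h2 := regPot_pos μ hn ht hμ x
    have h3 := regPot_le_one μ hn ht hle x
    exact le_div_self (by positivity) h2 h3

lemma measure_eq_zero_of_cap_eq_zero (hn : 3 ≤ n) (hμ : μ ≠ 0) (hle : ∀ x, Ppot n μ x ≤ 1)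
    {k : Set (V n)} (hk : IsCompact k) (h0 : cap n k = 0) : μ k = 0 := by
  have hle : μ.real k ≤ 0 := by
    refine le_of_forall_pos_lt_add fun ε hε => ?_
    obtain ⟨u, hu, hu1, hlt⟩ := exists_test_of_cap_eq_zero hk h0 hε
    rw [zero_add]
    refine lt_of_le_of_lt ?_ hlt
    refine le_trans ?_ (integral_sq_le μ hn hμ hle hu)
    have hs : HasCompactSupport fun x => u x ^ 2 := hu.2.mono fun x hx => by
      contrapose! hx
      simp [Function.notMem_support.1 hx]
    have hi : Integrable (fun x => u x ^ 2) μ :=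
      (hu.1.continuous.pow 2).integrable_of_hasCompactSupport hs
    calc μ.real k = ∫ x in k, (1 : ℝ) ∂μ := by simp
      _ ≤ ∫ x in k, u x ^ 2 ∂μ := by
          refine setIntegral_mono_on (integrable_const _) hi.integrableOn hk.measurableSet
            fun x hx => ?_
          have h1 := hu1 x hx
          nlinarith
      _ ≤ _ := setIntegral_le_integral hi (ae_of_all _ fun x => by
          rw [Pi.zero_apply]; positivity)
  exact (measureReal_eq_zero_iff (by finiteness)).1 (le_antisymm hle measureReal_nonneg)

/-- The exceptional set of an equilibrium potential is null for Lebesgue measure and for the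
equilibrium measure. -/
lemma null_exceptional (hn : 3 ≤ n) (hμ : μ ≠ 0) (hle : ∀ x, Ppot n μ x ≤ 1) {e : Set (V n)}
    (he : IsCompact e)
    (hqe : ∀ k : Set (V n), IsCompact k → k ⊆ {x ∈ e | Ppot n μ x ≠ 1} → cap n k = 0) :
    volume {x ∈ e | Ppot n μ x ≠ 1} = 0 ∧ μ {x ∈ e | Ppot n μ x ≠ 1} = 0 := by
  have hm : MeasurableSet {x ∈ e | Ppot n μ x ≠ 1} :=
    he.measurableSet.inter ((measurable_Ppot μ hn hle) (measurableSet_singleton 1).compl)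
  constructor
  · by_contra hne
    obtain ⟨k, hk, hkc, hpos⟩ := hm.exists_lt_isCompact_of_ne_top
      ((measure_mono (Set.sep_subset _ _)).trans_lt he.measure_lt_top).ne (pos_iff_ne_zero.2 hne)
    exact hpos.ne' (volume_eq_zero_of_cap_eq_zero μ hn hμ hkc (hqe k hkc hk))
  · by_contra hne
    obtain ⟨k, hk, hkc, hpos⟩ := hm.exists_lt_isCompact_of_ne_top
      (measure_ne_top μ _) (pos_iff_ne_zero.2 hne)
    exact hpos.ne' (measure_eq_zero_of_cap_eq_zero μ hn hμ hle hkc (hqe k hkc hk))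

end Null

/-- Fatou's lemma for nonnegative real functions. -/
lemma integrable_and_integral_le_of_tendsto {α : Type*} [MeasurableSpace α] {ν : Measure α}
    {F : ℕ → α → ℝ} {f : α → ℝ} {a : ℕ → ℝ} {A : ℝ} (hF : ∀ᶠ j in atTop, Integrable (F j) ν)
    (h0 : ∀ j x, 0 ≤ F j x) (hFm : ∀ j, Measurable (F j))
    (hlim : ∀ᵐ x ∂ν, Tendsto (fun j => F j x) atTop (𝓝 (f x)))
    (hle : ∀ᶠ j in atTop, ∫ x, F j x ∂ν ≤ a j) (ha : Tendsto a atTop (𝓝 A)) :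
    Integrable f ν ∧ ∫ x, f x ∂ν ≤ A := by
  have hf0 : 0 ≤ᵐ[ν] f := hlim.mono fun x hx => ge_of_tendsto' hx fun j => h0 j x
  have hfm : AEStronglyMeasurable f ν :=
    aestronglyMeasurable_of_tendsto_ae atTop (fun j => (hFm j).aestronglyMeasurable) hlim
  have hA0 : 0 ≤ A := ge_of_tendsto ha (hle.mono fun j hj => (integral_nonneg (h0 j)).trans hj)
  have hlin : ∫⁻ x, ENNReal.ofReal (f x) ∂ν ≤ ENNReal.ofReal A := by
    have h1 := lintegral_liminf_le (μ := ν) (u := atTop)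
      (f := fun j x => ENNReal.ofReal (F j x)) fun j => (hFm j).ennreal_ofReal
    have h2 : ∫⁻ x, liminf (fun j => ENNReal.ofReal (F j x)) atTop ∂ν
        = ∫⁻ x, ENNReal.ofReal (f x) ∂ν := by
      refine lintegral_congr_ae (hlim.mono fun x hx => ?_)
      exact ((ENNReal.continuous_ofReal.tendsto _).comp hx).liminf_eq
    rw [h2] at h1
    refine h1.trans ?_
    have h3 : Tendsto (fun j => ENNReal.ofReal (a j)) atTop (𝓝 (ENNReal.ofReal A)) :=
      (ENNReal.continuous_ofReal.tendsto _).comp ha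
    rw [← h3.liminf_eq]
    refine liminf_le_liminf ?_
    filter_upwards [hF, hle] with j hj1 hj2
    rw [← ofReal_integral_eq_lintegral_ofReal hj1 (ae_of_all _ (h0 j))]
    exact ENNReal.ofReal_le_ofReal hj2
  refine ⟨⟨hfm, ?_⟩, ?_⟩
  · rw [hasFiniteIntegral_iff_ofReal hf0]
    exact hlin.trans_lt ENNReal.ofReal_lt_top
  · rw [integral_eq_lintegral_of_nonneg_ae hf0 hfm]
    exact ENNReal.toReal_le_of_le_ofReal hA0 hlin

section Energy

variable {n : ℕ} (μ : Measure (V n)) [IsFiniteMeasure μ]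

lemma tendsto_integral_mul_regDens_seq (hn : 3 ≤ n) {f : V n → ℝ} (hf : Continuous f)
    (hs : HasCompactSupport f) :
    Tendsto (fun j => ∫ x, f x * regDens n μ (regParam j) x) atTop (𝓝 (∫ y, f y ∂μ)) :=
  (tendsto_integral_mul_regDens hn μ hf hs).comp
    (tendsto_atTop_add_const_right _ _ tendsto_natCast_atTop_atTop)

lemma regPot_mono_seq (hn : 3 ≤ n) {l j : ℕ} (h : l ≤ j) (x : V n) :
    regPot n μ (regParam l) x ≤ regPot n μ (regParam j) x :=
  regPot_anti μ hn (regParam_pos j) (regParam_anti h) x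

lemma continuous_fderiv_regPot (hn : 3 ≤ n) (j : ℕ) :
    Continuous (fderiv ℝ (regPot n μ (regParam j))) :=
  (contDiff_regPot μ hn (regParam_pos j)).1.continuous_fderiv (by norm_num)

/-- The energy of the layers of the regularized potentials. -/
lemma tendsto_layer_energy (hn : 3 ≤ n) (hμ : μ ≠ 0) (hle : ∀ x, Ppot n μ x ≤ 1)
    (hP1 : ∀ᵐ y ∂μ, Ppot n μ y = 1) {g : ℝ → ℝ} (hg : Continuous g) (hg0 : ∀ s, 0 ≤ g s)
    {χ : V n → ℝ} (hχ : IsTestR χ) (hχ0 : ∀ x, 0 ≤ χ x) (hχe : ∀ᵐ y ∂μ, χ y = 1)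
    (hχP : ∀ x, ∀ s ≤ Ppot n μ x, χ x ≠ 1 → ∫ u in (0 : ℝ)..s, g u = 0) :
    Tendsto (fun j => ∫ x, g (regPot n μ (regParam j) x) *
      ‖fderiv ℝ (regPot n μ (regParam j)) x‖ ^ 2) atTop
      (𝓝 ((∫ u in (0 : ℝ)..1, g u) * μ.real Set.univ)) := by
  set φ : ℝ → ℝ := fun s => ∫ u in (0 : ℝ)..s, g u with hφ
  set P : ℕ → V n → ℝ := fun j => regPot n μ (regParam j) with hP
  set L : ℕ → V n → ℝ := fun j => regDens n μ (regParam j) with hL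
  have hφd : ∀ s, HasDerivAt φ (g s) s := fun s => (hg.integral_hasStrictDerivAt 0 s).hasDerivAt
  have hφc : Continuous φ := continuous_iff_continuousAt.2 fun s => (hφd s).continuousAt
  have hφm : Monotone φ := monotone_of_hasDerivAt_nonneg hφd hg0
  have hφ00 : φ 0 = 0 := by simp [hφ]
  have hPpos : ∀ j x, 0 < P j x := fun j x => regPot_pos μ hn (regParam_pos j) hμ x
  have hPle : ∀ j x, P j x ≤ Ppot n μ x := fun j x => regPot_le_Ppot μ hn (regParam_pos j) hle x
  have hPc : ∀ j, Continuous (P j) := fun j => (contDiff_regPot μ hn (regParam_pos j)).1.continuous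
  have hLc : ∀ j, Continuous (L j) := fun j => continuous_regDens μ (regParam_pos j)
  have hLpos : ∀ j x, 0 < L j x := fun j x => regDens_pos μ (regParam_pos j) hμ x
  have hφP0 : ∀ j x, 0 ≤ φ (P j x) := fun j x => hφ00 ▸ hφm (hPpos j x).le
  have hφP1 : ∀ j x, φ (P j x) ≤ φ 1 := fun j x => hφm ((hPle j x).trans (hle x))
  have hφPχ : ∀ j x, χ x ≠ 1 → φ (P j x) = 0 := fun j x hx => hχP x _ (hPle j x) hx
  have hsup : ∀ j, HasCompactSupport fun x => φ (P j x) := fun j => hχ.2.mono fun x hx => by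
    contrapose! hx
    rw [Function.notMem_support] at hx ⊢
    exact hφPχ j x (by rw [hx]; norm_num)
  have hI : ∀ j, ∫ x, g (P j x) * ‖fderiv ℝ (P j) x‖ ^ 2 = ∫ x, φ (P j x) * L j x := by
    intro j
    obtain ⟨h1, -, h3⟩ := contDiff_regPot μ hn (regParam_pos j)
    have h := integral_comp_energy hφd hg h1 (hsup j)
    simpa [h3] using h
  have hintL : ∀ (f : V n → ℝ) (j : ℕ), Continuous f → HasCompactSupport f →
      Integrable fun x => f x * L j x := fun f j hf hs =>
    (hf.mul (hLc j)).integrable_of_hasCompactSupport hs.mul_right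
  change Tendsto (fun j => ∫ x, g (P j x) * ‖fderiv ℝ (P j) x‖ ^ 2) atTop
    (𝓝 (φ 1 * μ.real Set.univ))
  simp_rw [hI]
  refine tendsto_order.2 ⟨fun a ha => ?_, fun b hb => ?_⟩
  · have hl : Tendsto (fun l => ∫ y, φ (P l y) ∂μ) atTop (𝓝 (∫ _, φ 1 ∂μ)) := by
      refine tendsto_integral_of_dominated_convergence (fun _ => φ 1)
        (fun l => (hφc.comp (hPc l)).aestronglyMeasurable) (integrable_const _)
        (fun l => ae_of_all _ fun y => ?_) ?_
      · rw [Real.norm_of_nonneg (hφP0 l y)]; exact hφP1 l y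
      · filter_upwards [hP1] with y hy
        refine (hφc.tendsto 1).comp ?_
        rw [← hy]
        exact tendsto_regPot μ hn hle y
    rw [integral_const, smul_eq_mul, mul_comm] at hl
    obtain ⟨l, hl'⟩ := (hl.eventually_const_lt ha).exists
    have hj := (tendsto_integral_mul_regDens_seq μ hn (hφc.comp (hPc l)) (hsup l)).eventually_const_lt
      hl'
    filter_upwards [hj, eventually_ge_atTop l] with j hj1 hj2
    refine hj1.trans_le (integral_mono (hintL _ j (hφc.comp (hPc l)) (hsup l))
      (hintL _ j (hφc.comp (hPc j)) (hsup j)) fun x => ?_)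
    exact mul_le_mul_of_nonneg_right (hφm (regPot_mono_seq μ hn hj2 x)) (hLpos j x).le
  · have hj := (tendsto_integral_mul_regDens_seq μ hn hχ.1.continuous hχ.2).const_mul (φ 1)
    have e1 : ∫ y, χ y ∂μ = μ.real Set.univ := by
      rw [integral_congr_ae hχe]; simp
    rw [e1] at hj
    filter_upwards [hj.eventually_lt_const hb] with j hj1
    refine lt_of_le_of_lt ?_ hj1
    rw [← integral_const_mul]
    refine integral_mono (hintL _ j (hφc.comp (hPc j)) (hsup j))
      ((hintL _ j hχ.1.continuous hχ.2).const_mul _) fun x => ?_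
    change φ (P j x) * L j x ≤ φ 1 * (χ x * L j x)
    rw [← mul_assoc]
    refine mul_le_mul_of_nonneg_right ?_ (hLpos j x).le
    by_cases hx : χ x = 1
    · rw [hx, mul_one]; exact hφP1 j x
    · rw [hφPχ j x hx]
      exact mul_nonneg ((hφP0 j x).trans (hφP1 j x)) (hχ0 x)

/-- A bound for the localized energy of `P - P_l`, tending to zero with `l`. -/
def gapBound (χ : V n → ℝ) (l : ℕ) : ℝ :=
  ∫ y, χ y * (1 - regPot n μ (regParam l) y) ∂μ
    + (1 / 2) * ∫ x, (Ppot n μ x - regPot n μ (regParam l) x) ^ 2 * |lap χ x|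

lemma hasCompactSupport_lap {χ : V n → ℝ} (hχ : IsTestR χ) : HasCompactSupport (lap χ) := by
  refine HasCompactSupport.intro hχ.2 fun x hx => ?_
  have h0 : χ =ᶠ[𝓝 x] 0 := notMem_tsupport_iff_eventuallyEq.1 hx
  have h1 : fderiv ℝ χ =ᶠ[𝓝 x] 0 := by
    have := h0.fderiv (𝕜 := ℝ)
    refine this.trans (Eventually.of_forall fun y => ?_)
    simp
  have h2 : fderiv ℝ (fderiv ℝ χ) x = 0 := by
    rw [h1.fderiv_eq]; simp
  simp [lap, h2]

lemma tendsto_gapBound (hn : 3 ≤ n) (hμ : μ ≠ 0) (hle : ∀ x, Ppot n μ x ≤ 1)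
    (hP1 : ∀ᵐ y ∂μ, Ppot n μ y = 1) {χ : V n → ℝ} (hχ : IsTestR χ) :
    Tendsto (gapBound μ χ) atTop (𝓝 0) := by
  have hPpos : ∀ j x, 0 < regPot n μ (regParam j) x := fun j x =>
    regPot_pos μ hn (regParam_pos j) hμ x
  have hPle : ∀ j x, regPot n μ (regParam j) x ≤ Ppot n μ x := fun j x =>
    regPot_le_Ppot μ hn (regParam_pos j) hle x
  have hPc : ∀ j, Continuous (regPot n μ (regParam j)) := fun j =>
    (contDiff_regPot μ hn (regParam_pos j)).1.continuous
  have hlc : Continuous (lap χ) := continuous_lap hχ.contDiff_two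
  have h1 : Tendsto (fun l => ∫ y, χ y * (1 - regPot n μ (regParam l) y) ∂μ) atTop
      (𝓝 (∫ _, (0 : ℝ) ∂μ)) := by
    refine tendsto_integral_of_dominated_convergence (fun y => ‖χ y‖)
      (fun l => (hχ.1.continuous.mul (continuous_const.sub (hPc l))).aestronglyMeasurable)
      (hχ.1.continuous.integrable_of_hasCompactSupport hχ.2).norm
      (fun l => ae_of_all _ fun y => ?_) ?_
    · rw [norm_mul]
      refine mul_le_of_le_one_right (norm_nonneg _) ?_
      have := hPpos l y
      have := hPle l y
      have := hle y
      rw [Real.norm_eq_abs, abs_le]; constructor <;> linarith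
    · filter_upwards [hP1] with y hy
      have h := ((tendsto_regPot μ hn hle y).const_sub 1).const_mul (χ y)
      simpa [hy] using h
  have h2 : Tendsto (fun l => ∫ x, (Ppot n μ x - regPot n μ (regParam l) x) ^ 2 * |lap χ x|) atTop
      (𝓝 (∫ _ : V n, (0 : ℝ))) := by
    refine tendsto_integral_of_dominated_convergence (fun x => |lap χ x|)
      (fun l => ?_) (hlc.integrable_of_hasCompactSupport (hasCompactSupport_lap hχ)).norm
      (fun l => ae_of_all _ fun y => ?_) (ae_of_all _ fun y => ?_)
    · exact ((((measurable_Ppot μ hn hle).sub (hPc l).measurable).pow_const 2).mul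
        hlc.abs.measurable).aestronglyMeasurable
    · rw [norm_mul, norm_pow, Real.norm_eq_abs, Real.norm_eq_abs, abs_abs]
      refine mul_le_of_le_one_left (abs_nonneg _) (pow_le_one₀ (abs_nonneg _) ?_)
      have := hPpos l y
      have := hPle l y
      have := hle y
      rw [abs_le]; constructor <;> linarith
    · have h := ((((tendsto_regPot μ hn hle y).const_sub (Ppot n μ y)).pow 2).mul_const |lap χ y|)
      simpa using h
  have h := h1.add (h2.const_mul (1 / 2))
  rw [integral_zero, integral_zero, mul_zero, add_zero] at h
  exact h

/-- The localized energy of `P_j - P_l`. -/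
lemma exists_gap_bound (hn : 3 ≤ n) (hμ : μ ≠ 0) (hle : ∀ x, Ppot n μ x ≤ 1)
    {χ : V n → ℝ} (hχ : IsTestR χ) (hχ0 : ∀ x, 0 ≤ χ x) (l : ℕ) :
    ∃ a : ℕ → ℝ, Tendsto a atTop (𝓝 (gapBound μ χ l)) ∧ ∀ j ≥ l,
      ∫ x, χ x * ‖fderiv ℝ (regPot n μ (regParam j)) x - fderiv ℝ (regPot n μ (regParam l)) x‖ ^ 2
        ≤ a j := by
  have hPpos : ∀ j x, 0 < regPot n μ (regParam j) x := fun j x =>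
    regPot_pos μ hn (regParam_pos j) hμ x
  have hPle : ∀ j x, regPot n μ (regParam j) x ≤ Ppot n μ x := fun j x =>
    regPot_le_Ppot μ hn (regParam_pos j) hle x
  have hC2 : ∀ j, ContDiff ℝ 2 (regPot n μ (regParam j)) := fun j =>
    (contDiff_regPot μ hn (regParam_pos j)).1
  have hPc : ∀ j, Continuous (regPot n μ (regParam j)) := fun j => (hC2 j).continuous
  have hχ2 : ContDiff ℝ 2 χ := hχ.contDiff_two
  have hlc : Continuous (lap χ) := continuous_lap hχ2
  have hχc := hχ.1.continuous
  have hLc : ∀ j, Continuous (regDens n μ (regParam j)) := fun j =>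
    continuous_regDens μ (regParam_pos j)
  have hLpos : ∀ j x, 0 < regDens n μ (regParam j) x := fun j x =>
    regDens_pos μ (regParam_pos j) hμ x
  refine ⟨fun j => (∫ x, χ x * (1 - regPot n μ (regParam l) x) * regDens n μ (regParam j) x)
    + (1 / 2) * ∫ x, (Ppot n μ x - regPot n μ (regParam l) x) ^ 2 * |lap χ x|, ?_, fun j hj => ?_⟩
  · refine Tendsto.add_const _ ?_
    exact tendsto_integral_mul_regDens_seq μ hn (hχc.mul (continuous_const.sub (hPc l)))
      hχ.2.mul_right
  · set w : V n → ℝ := fun x => regPot n μ (regParam j) x - regPot n μ (regParam l) x with hw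
    have hw2 : ContDiff ℝ 2 w := (hC2 j).sub (hC2 l)
    have hw0 : ∀ x, 0 ≤ w x := fun x => sub_nonneg.2 (regPot_mono_seq μ hn hj x)
    have hwl : ∀ x, w x ≤ Ppot n μ x - regPot n μ (regParam l) x := fun x =>
      sub_le_sub_right (hPle j x) _
    have hwD : ∀ x, fderiv ℝ w x
        = fderiv ℝ (regPot n μ (regParam j)) x - fderiv ℝ (regPot n μ (regParam l)) x := fun x =>
      fderiv_sub ((hC2 j).differentiable (by norm_num) x) ((hC2 l).differentiable (by norm_num) x)
    have hwL : ∀ x, -lap w x = regDens n μ (regParam j) x - regDens n μ (regParam l) x := fun x => by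
      have h1 := (contDiff_regPot μ hn (regParam_pos j)).2.2 x
      have h2 := (contDiff_regPot μ hn (regParam_pos l)).2.2 x
      have h3 : lap w x = lap (regPot n μ (regParam j)) x - lap (regPot n μ (regParam l)) x :=
        lap_sub (hC2 j) (hC2 l) x
      rw [h3, h1, h2]; ring
    simp_rw [← hwD]
    rw [integral_cutoff_energy hχ2 hχ.2 hw2]
    refine add_le_add ?_ (mul_le_mul_of_nonneg_left ?_ (by norm_num))
    · refine integral_mono ?_ ?_ fun x => ?_
      · exact ((hχc.mul hw2.continuous).mul
          (continuous_lap hw2).neg).integrable_of_hasCompactSupport hχ.2.mul_right.mul_right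
      · exact ((hχc.mul (continuous_const.sub (hPc l))).mul
          (hLc j)).integrable_of_hasCompactSupport hχ.2.mul_right.mul_right
      · change χ x * w x * (-lap w x)
          ≤ χ x * (1 - regPot n μ (regParam l) x) * regDens n μ (regParam j) x
        rw [hwL]
        have h1 := hw0 x
        have h2 : w x ≤ 1 - regPot n μ (regParam l) x := (hwl x).trans (sub_le_sub_right (hle x) _)
        have h3 := hLpos j x
        have h4 := hLpos l x
        have h5 := hχ0 x
        calc χ x * w x * (regDens n μ (regParam j) x - regDens n μ (regParam l) x)
            ≤ χ x * w x * regDens n μ (regParam j) x := by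
              gcongr
              linarith
          _ ≤ _ := by gcongr
    · have hdom : Integrable fun x => |lap χ x| :=
        (hlc.integrable_of_hasCompactSupport (hasCompactSupport_lap hχ)).norm
      refine integral_mono ?_ ?_ fun x => ?_
      · exact ((hw2.continuous.pow 2).mul hlc).integrable_of_hasCompactSupport
          (hasCompactSupport_lap hχ).mul_left
      · refine hdom.mono' ?_ (ae_of_all _ fun x => ?_)
        · exact ((((measurable_Ppot μ hn hle).sub (hPc l).measurable).pow_const 2).mul
            hlc.abs.measurable).aestronglyMeasurable
        · rw [norm_mul, norm_pow, Real.norm_eq_abs, Real.norm_eq_abs, abs_abs]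
          refine mul_le_of_le_one_left (abs_nonneg _) (pow_le_one₀ (abs_nonneg _) ?_)
          have := hPpos l x
          have := hPle l x
          have := hle x
          rw [abs_le]; constructor <;> linarith
      · have h1 := hw0 x
        have h2 := hwl x
        calc w x ^ 2 * lap χ x ≤ w x ^ 2 * |lap χ x| := by
              gcongr
              exact le_abs_self _
          _ ≤ (Ppot n μ x - regPot n μ (regParam l) x) ^ 2 * |lap χ x| := by gcongr

end Energy

section Layer

variable {n : ℕ} (μ : Measure (V n)) [IsFiniteMeasure μ]

/-- The localized energy of `P - P_l` off the support. -/
lemma integrableOn_gap (hn : 3 ≤ n) (hμ : μ ≠ 0) (hle : ∀ x, Ppot n μ x ≤ 1)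
    {e : Set (V n)} (he : IsClosed e) (hsupp : μ eᶜ = 0)
    {χ : V n → ℝ} (hχ : IsTestR χ) (hχ0 : ∀ x, 0 ≤ χ x) (l : ℕ) :
    IntegrableOn (fun x => χ x * ‖fderiv ℝ (Ppot n μ) x - fderiv ℝ (regPot n μ (regParam l)) x‖ ^ 2)
      eᶜ ∧ ∫ x in eᶜ, χ x * ‖fderiv ℝ (Ppot n μ) x - fderiv ℝ (regPot n μ (regParam l)) x‖ ^ 2
        ≤ gapBound μ χ l := by
  obtain ⟨a, ha, hle'⟩ := exists_gap_bound μ hn hμ hle hχ hχ0 l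
  have hcont : ∀ j, Continuous fun x => χ x *
      ‖fderiv ℝ (regPot n μ (regParam j)) x - fderiv ℝ (regPot n μ (regParam l)) x‖ ^ 2 := fun j =>
    hχ.1.continuous.mul (((continuous_fderiv_regPot μ hn j).sub
      (continuous_fderiv_regPot μ hn l)).norm.pow 2)
  have hint : ∀ j, Integrable fun x => χ x *
      ‖fderiv ℝ (regPot n μ (regParam j)) x - fderiv ℝ (regPot n μ (regParam l)) x‖ ^ 2 := fun j =>
    (hcont j).integrable_of_hasCompactSupport hχ.2.mul_right
  have h0 : ∀ j x, 0 ≤ χ x *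
      ‖fderiv ℝ (regPot n μ (regParam j)) x - fderiv ℝ (regPot n μ (regParam l)) x‖ ^ 2 :=
    fun j x => mul_nonneg (hχ0 x) (by positivity)
  refine integrable_and_integral_le_of_tendsto (Eventually.of_forall fun j => (hint j).integrableOn)
    h0 (fun j => (hcont j).measurable) ?_ ?_ ha
  · refine (ae_restrict_iff' he.isOpen_compl.measurableSet).2 (ae_of_all _ fun x hx => ?_)
    exact (((hasFDerivAt_Ppot μ hn hle he hsupp hx).2.sub_const _).norm.pow 2).const_mul _
  · filter_upwards [eventually_ge_atTop l] with j hj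
    exact (setIntegral_le_integral (hint j) (ae_of_all _ (h0 j))).trans (hle' j hj)

/-- The energy of a layer of the potential. -/
theorem layer_energy (hn : 3 ≤ n) (hμ : μ ≠ 0) (hle : ∀ x, Ppot n μ x ≤ 1)
    {e : Set (V n)} (he : IsCompact e) (hsupp : μ eᶜ = 0)
    (hP1 : ∀ᵐ y ∂μ, Ppot n μ y = 1) (hPe : ∀ᵐ x, x ∈ e → Ppot n μ x = 1)
    {g : ℝ → ℝ} (hg : Continuous g) (hg0 : ∀ s, 0 ≤ g s) {s₀ M : ℝ} (hs₀ : 0 < s₀)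
    (hgs : ∀ s ≤ s₀, g s = 0) (hg1 : g 1 = 0) (hgM : ∀ s, g s ≤ M) :
    IntegrableOn (fun x => g (Ppot n μ x) * ‖fderiv ℝ (Ppot n μ) x‖ ^ 2) eᶜ ∧
      ∫ x in eᶜ, g (Ppot n μ x) * ‖fderiv ℝ (Ppot n μ) x‖ ^ 2
        = (∫ u in (0 : ℝ)..1, g u) * μ.real Set.univ := by
  have hM0 : 0 ≤ M := (hg0 0).trans (hgM 0)
  have hem : MeasurableSet eᶜ := he.isClosed.isOpen_compl.measurableSet
  obtain ⟨R, hR, heR, hPR⟩ := exists_Ppot_lt μ hn he hsupp hs₀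
  obtain ⟨χ, hχ, hχ1, hχ0, hχle⟩ := exists_cutoff (n := n) (Metric.isBounded_ball (x := 0) (r := R))
  have hχP : ∀ x, χ x ≠ 1 → Ppot n μ x < s₀ := fun x hx =>
    hPR x (by by_contra hcon; exact hx (hχ1 x (by simpa using hcon)))
  have hae : ∀ᵐ y ∂μ, y ∈ e := by rw [ae_iff]; exact hsupp
  set P : ℕ → V n → ℝ := fun j => regPot n μ (regParam j) with hP
  have hPle : ∀ j x, P j x ≤ Ppot n μ x := fun j x => regPot_le_Ppot μ hn (regParam_pos j) hle x
  have hPc : ∀ j, Continuous (P j) := fun j => (contDiff_regPot μ hn (regParam_pos j)).1.continuous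
  have hDc : ∀ j, Continuous (fderiv ℝ (P j)) := continuous_fderiv_regPot μ hn
  have hlim : ∀ x, Tendsto (fun j => P j x) atTop (𝓝 (Ppot n μ x)) := tendsto_regPot μ hn hle
  have hI := tendsto_layer_energy μ hn hμ hle hP1 hg hg0 hχ hχ0
    (hae.mono fun y hy => hχ1 y (heR hy)) (fun x s hs hx => by
      rw [intervalIntegral.integral_congr (g := fun _ => (0 : ℝ)) fun u hu => ?_]
      · simp
      · refine hgs u ((Set.mem_uIcc.1 hu).elim (fun h => ?_) fun h => ?_)
        · linarith [hχP x hx]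
        · linarith)
  have hgχ : ∀ {x s}, s ≤ Ppot n μ x → g s ≤ M * χ x := fun {x s} hs => by
    by_cases hx : χ x = 1
    · rw [hx, mul_one]; exact hgM s
    · rw [hgs s (hs.trans (hχP x hx).le)]
      exact mul_nonneg hM0 (hχ0 x)
  have hgsup : ∀ (f : V n → ℝ), (∀ x, f x ≤ Ppot n μ x) → HasCompactSupport fun x => g (f x) :=
    fun f hf => hχ.2.mono fun x hx => by
      contrapose! hx
      rw [Function.notMem_support] at hx ⊢
      exact hgs _ ((hf x).trans (hχP x (by rw [hx]; norm_num)).le)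
  have hint : ∀ j l, Integrable fun x => g (P j x) * ‖fderiv ℝ (P l) x‖ ^ 2 := fun j l =>
    ((hg.comp (hPc j)).mul ((hDc l).norm.pow 2)).integrable_of_hasCompactSupport
      (hgsup _ (hPle j)).mul_right
  have hupper : IntegrableOn (fun x => g (Ppot n μ x) * ‖fderiv ℝ (Ppot n μ) x‖ ^ 2) eᶜ ∧
      ∫ x in eᶜ, g (Ppot n μ x) * ‖fderiv ℝ (Ppot n μ) x‖ ^ 2
        ≤ (∫ u in (0 : ℝ)..1, g u) * μ.real Set.univ := by
    refine integrable_and_integral_le_of_tendsto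
      (F := fun j x => g (P j x) * ‖fderiv ℝ (P j) x‖ ^ 2)
      (Eventually.of_forall fun j => (hint j j).integrableOn)
      (fun j x => mul_nonneg (hg0 _) (by positivity))
      (fun j => ((hg.comp (hPc j)).mul ((hDc j).norm.pow 2)).measurable) ?_
      (Eventually.of_forall fun j => ?_) hI
    · refine (ae_restrict_iff' hem).2 (ae_of_all _ fun x hx => ?_)
      exact ((hg.tendsto _).comp (hlim x)).mul
        ((hasFDerivAt_Ppot μ hn hle he.isClosed hsupp hx).2.norm.pow 2)
    · exact setIntegral_le_integral (hint j j)
        (ae_of_all _ fun x => mul_nonneg (hg0 _) (by positivity))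
  refine ⟨hupper.1, le_antisymm hupper.2 ?_⟩
  set J := ∫ x in eᶜ, g (Ppot n μ x) * ‖fderiv ℝ (Ppot n μ) x‖ ^ 2 with hJ
  set A := (∫ u in (0 : ℝ)..1, g u) * μ.real Set.univ with hA
  have hstep1 : ∀ η > 0, ∀ l, A ≤ (1 + η) * (∫ x, g (Ppot n μ x) * ‖fderiv ℝ (P l) x‖ ^ 2)
      + (1 + η⁻¹) * (M * gapBound μ χ l) := by
    intro η hη l
    obtain ⟨a, ha, hle'⟩ := exists_gap_bound μ hn hμ hle hχ hχ0 l
    have h1 : Tendsto (fun j => ∫ x, g (P j x) * ‖fderiv ℝ (P l) x‖ ^ 2) atTop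
        (𝓝 (∫ x, g (Ppot n μ x) * ‖fderiv ℝ (P l) x‖ ^ 2)) := by
      refine tendsto_integral_of_dominated_convergence
        (fun x => M * χ x * ‖fderiv ℝ (P l) x‖ ^ 2)
        (fun j => (hint j l).aestronglyMeasurable) ?_ (fun j => ae_of_all _ fun x => ?_)
        (ae_of_all _ fun x => ?_)
      · exact ((continuous_const.mul hχ.1.continuous).mul
          ((hDc l).norm.pow 2)).integrable_of_hasCompactSupport hχ.2.mul_left.mul_right
      · rw [Real.norm_of_nonneg (mul_nonneg (hg0 _) (by positivity))]
        gcongr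
        exact hgχ (hPle j x)
      · exact ((hg.tendsto _).comp (hlim x)).mul_const _
    refine le_of_tendsto_of_tendsto hI
      ((h1.const_mul (1 + η)).add ((ha.const_mul M).const_mul (1 + η⁻¹))) ?_
    filter_upwards [eventually_ge_atTop l] with j hj
    have hgi : Integrable fun x => χ x * ‖fderiv ℝ (P j) x - fderiv ℝ (P l) x‖ ^ 2 :=
      (hχ.1.continuous.mul (((hDc j).sub
        (hDc l)).norm.pow 2)).integrable_of_hasCompactSupport hχ.2.mul_right
    calc ∫ x, g (P j x) * ‖fderiv ℝ (P j) x‖ ^ 2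
        ≤ ∫ x, ((1 + η) * (g (P j x) * ‖fderiv ℝ (P l) x‖ ^ 2)
          + (1 + η⁻¹) * (M * (χ x * ‖fderiv ℝ (P j) x - fderiv ℝ (P l) x‖ ^ 2))) := by
          refine integral_mono (hint j j) (((hint j l).const_mul _).add
            ((hgi.const_mul _).const_mul _)) fun x => ?_
          have h2 := norm_add_sq_le_eta (fderiv ℝ (P l) x)
            (fderiv ℝ (P j) x - fderiv ℝ (P l) x) hη
          rw [add_sub_cancel] at h2
          have h3 := hg0 (P j x)
          calc g (P j x) * ‖fderiv ℝ (P j) x‖ ^ 2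
              ≤ g (P j x) * ((1 + η) * ‖fderiv ℝ (P l) x‖ ^ 2
                + (1 + η⁻¹) * ‖fderiv ℝ (P j) x - fderiv ℝ (P l) x‖ ^ 2) := by gcongr
            _ = (1 + η) * (g (P j x) * ‖fderiv ℝ (P l) x‖ ^ 2)
                + (1 + η⁻¹) * (g (P j x) * ‖fderiv ℝ (P j) x - fderiv ℝ (P l) x‖ ^ 2) := by ring
            _ ≤ (1 + η) * (g (P j x) * ‖fderiv ℝ (P l) x‖ ^ 2)
                + (1 + η⁻¹) * (M * χ x * ‖fderiv ℝ (P j) x - fderiv ℝ (P l) x‖ ^ 2) := by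
                gcongr
                exact hgχ (hPle j x)
            _ = _ := by ring
      _ = (1 + η) * (∫ x, g (P j x) * ‖fderiv ℝ (P l) x‖ ^ 2)
          + (1 + η⁻¹) * (M * ∫ x, χ x * ‖fderiv ℝ (P j) x - fderiv ℝ (P l) x‖ ^ 2) := by
          rw [integral_add ((hint j l).const_mul _) ((hgi.const_mul _).const_mul _),
            integral_const_mul, integral_const_mul, integral_const_mul]
      _ ≤ _ := by
          gcongr
          exact hle' j hj
  have hstep2 : ∀ η > 0, ∀ l, ∫ x, g (Ppot n μ x) * ‖fderiv ℝ (P l) x‖ ^ 2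
      ≤ (1 + η) * J + (1 + η⁻¹) * (M * gapBound μ χ l) := by
    intro η hη l
    obtain ⟨hgi, hgle⟩ := integrableOn_gap μ hn hμ hle he.isClosed hsupp hχ hχ0 l
    have hz : ∫ x, g (Ppot n μ x) * ‖fderiv ℝ (P l) x‖ ^ 2
        = ∫ x in eᶜ, g (Ppot n μ x) * ‖fderiv ℝ (P l) x‖ ^ 2 := by
      symm
      refine setIntegral_eq_integral_of_ae_compl_eq_zero ?_
      filter_upwards [hPe] with x hx hxe
      rw [hx (Set.notMem_compl_iff.1 hxe), hg1, zero_mul]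
    rw [hz]
    calc ∫ x in eᶜ, g (Ppot n μ x) * ‖fderiv ℝ (P l) x‖ ^ 2
        ≤ ∫ x in eᶜ, ((1 + η) * (g (Ppot n μ x) * ‖fderiv ℝ (Ppot n μ) x‖ ^ 2)
          + (1 + η⁻¹) * (M * (χ x * ‖fderiv ℝ (Ppot n μ) x - fderiv ℝ (P l) x‖ ^ 2))) := by
          refine integral_mono_of_nonneg (ae_of_all _ fun x => mul_nonneg (hg0 _) (by positivity))
            ((hupper.1.const_mul _).add ((hgi.const_mul _).const_mul _)) (ae_of_all _ fun x => ?_)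
          have h2 := norm_add_sq_le_eta (fderiv ℝ (Ppot n μ) x)
            (fderiv ℝ (P l) x - fderiv ℝ (Ppot n μ) x) hη
          rw [add_sub_cancel, norm_sub_rev] at h2
          have h3 := hg0 (Ppot n μ x)
          calc g (Ppot n μ x) * ‖fderiv ℝ (P l) x‖ ^ 2
              ≤ g (Ppot n μ x) * ((1 + η) * ‖fderiv ℝ (Ppot n μ) x‖ ^ 2
                + (1 + η⁻¹) * ‖fderiv ℝ (Ppot n μ) x - fderiv ℝ (P l) x‖ ^ 2) := by gcongr
            _ = (1 + η) * (g (Ppot n μ x) * ‖fderiv ℝ (Ppot n μ) x‖ ^ 2) + (1 + η⁻¹) *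
                (g (Ppot n μ x) * ‖fderiv ℝ (Ppot n μ) x - fderiv ℝ (P l) x‖ ^ 2) := by ring
            _ ≤ (1 + η) * (g (Ppot n μ x) * ‖fderiv ℝ (Ppot n μ) x‖ ^ 2) + (1 + η⁻¹) *
                (M * χ x * ‖fderiv ℝ (Ppot n μ) x - fderiv ℝ (P l) x‖ ^ 2) := by
                gcongr
                exact hgχ le_rfl
            _ = _ := by ring
      _ = (1 + η) * J + (1 + η⁻¹) * (M * ∫ x in eᶜ,
          χ x * ‖fderiv ℝ (Ppot n μ) x - fderiv ℝ (P l) x‖ ^ 2) := by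
          rw [integral_add (hupper.1.const_mul _) ((hgi.const_mul _).const_mul _),
            integral_const_mul, integral_const_mul, integral_const_mul]
      _ ≤ _ := by gcongr
  have hb := tendsto_gapBound μ hn hμ hle hP1 hχ
  have hη : ∀ η > 0, A ≤ (1 + η) * ((1 + η) * J) := by
    intro η hη
    have h1 := (hb.const_mul M).const_mul (1 + η⁻¹)
    have h2 := ((h1.const_add ((1 + η) * J)).const_mul (1 + η)).add h1
    simp only [mul_zero, add_zero] at h2
    refine ge_of_tendsto' h2 fun l => (hstep1 η hη l).trans ?_
    gcongr
    exact hstep2 η hη l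
  have hlimη : Tendsto (fun η : ℝ => (1 + η) * ((1 + η) * J)) (𝓝[>] 0) (𝓝 J) := by
    have : Continuous fun η : ℝ => (1 + η) * ((1 + η) * J) := by fun_prop
    have h := this.tendsto 0
    simp only [add_zero, one_mul] at h
    exact h.mono_left nhdsWithin_le_nhds
  exact ge_of_tendsto hlimη (eventually_mem_nhdsWithin.mono fun η h => hη η h)

end Layer

section Cutoff

/-- Continuous cutoffs on `(0, 1)` increasing to one with `k`. -/
def layerCutoff (k s : ℝ) : ℝ := max 0 (min 1 (min (k * s - 1) (k * (1 - s) - 1)))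

lemma layerCutoff_nonneg (k s : ℝ) : 0 ≤ layerCutoff k s := le_max_left _ _

lemma layerCutoff_le_one (k s : ℝ) : layerCutoff k s ≤ 1 :=
  max_le zero_le_one (min_le_left _ _)

lemma layerCutoff_eq_zero {k s : ℝ} (h : k * s ≤ 1) : layerCutoff k s = 0 :=
  max_eq_left ((min_le_right _ _).trans ((min_le_left _ _).trans (by linarith)))

lemma layerCutoff_eq_zero' {k s : ℝ} (hk : 0 ≤ k) (h : 1 ≤ s) : layerCutoff k s = 0 :=
  max_eq_left ((min_le_right _ _).trans ((min_le_right _ _).trans (by nlinarith)))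

lemma layerCutoff_mono {k l s : ℝ} (h : k ≤ l) (hs : 0 ≤ s) (hs1 : s ≤ 1) :
    layerCutoff k s ≤ layerCutoff l s := by
  have : 0 ≤ 1 - s := by linarith
  unfold layerCutoff
  gcongr

lemma eventually_layerCutoff_eq_one {s : ℝ} (hs : 0 < s) (hs1 : s < 1) :
    ∀ᶠ k in atTop, layerCutoff k s = 1 := by
  have hs2 : 0 < 1 - s := by linarith
  filter_upwards [eventually_ge_atTop (2 / s), eventually_ge_atTop (2 / (1 - s))] with k h1 h2
  rw [div_le_iff₀ hs] at h1
  rw [div_le_iff₀ hs2] at h2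
  unfold layerCutoff
  rw [min_eq_left (le_min (by linarith) (by linarith)), max_eq_right zero_le_one]

/-- The truncated power `s ^ q` with the cutoff `layerCutoff k`. -/
def layerPow (q k s : ℝ) : ℝ := max s k⁻¹ ^ q * layerCutoff k s

variable {q k s : ℝ}

lemma layerPow_nonneg (hk : 0 < k) : 0 ≤ layerPow q k s := by
  have : 0 < max s k⁻¹ := lt_max_of_lt_right (by positivity)
  exact mul_nonneg (by positivity) (layerCutoff_nonneg k s)

lemma continuous_layerPow (hk : 0 < k) : Continuous (layerPow q k) := by
  unfold layerPow layerCutoff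
  refine Continuous.mul ?_ (by fun_prop)
  exact (by fun_prop : Continuous fun s : ℝ => max s k⁻¹).rpow_const fun s =>
    Or.inl (lt_max_of_lt_right (by positivity) : 0 < max s k⁻¹).ne'

lemma layerPow_eq (hk : 0 < k) : layerPow q k s = s ^ q * layerCutoff k s := by
  rcases le_total (k * s) 1 with h | h
  · rw [layerPow, layerCutoff_eq_zero h, mul_zero, mul_zero]
  · rw [layerPow, max_eq_left]
    rwa [inv_le_iff_one_le_mul₀' hk]

lemma exists_layerPow_le (hk : 0 < k) : ∃ M, ∀ s, layerPow q k s ≤ M := by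
  refine (continuous_layerPow hk).bddAbove_range_of_hasCompactSupport ?_ |>.imp fun M hM s =>
    hM ⟨s, rfl⟩
  refine HasCompactSupport.intro (isCompact_Icc (a := 0) (b := 1)) fun s hs => ?_
  rw [layerPow]
  rw [Set.mem_Icc, not_and_or, not_le, not_le] at hs
  rcases hs with hs | hs
  · rw [layerCutoff_eq_zero (by nlinarith), mul_zero]
  · rw [layerCutoff_eq_zero' hk.le hs.le, mul_zero]

lemma tendsto_integral_layerPow (hq : -1 < q) :
    Tendsto (fun j : ℕ => ∫ s in (0 : ℝ)..1, layerPow q ((j : ℝ) + 1) s) atTop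
      (𝓝 (1 / (q + 1))) := by
  have hval : ∫ s in (0 : ℝ)..1, s ^ q = 1 / (q + 1) := by
    rw [integral_rpow (Or.inl hq), Real.one_rpow, Real.zero_rpow (by linarith), sub_zero]
  rw [← hval]
  refine intervalIntegral.tendsto_integral_filter_of_dominated_convergence (fun s => s ^ q)
    (Eventually.of_forall fun j => (continuous_layerPow (by positivity)).aestronglyMeasurable)
    (Eventually.of_forall fun j => ae_of_all _ fun s hs => ?_)
    (intervalIntegral.intervalIntegrable_rpow' hq) ?_
  · rw [Set.uIoc_of_le zero_le_one] at hs
    have hs0 : 0 < s := hs.1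
    rw [Real.norm_of_nonneg (layerPow_nonneg (by positivity)), layerPow_eq (by positivity)]
    exact mul_le_of_le_one_right (by positivity) (layerCutoff_le_one _ _)
  · have h1 : ∀ᵐ s : ℝ, s ≠ 1 := by simp [ae_iff]
    filter_upwards [h1] with s hs1 hs
    rw [Set.uIoc_of_le zero_le_one] at hs
    have h2 := (tendsto_atTop_add_const_right _ (1 : ℝ)
      tendsto_natCast_atTop_atTop).eventually
      (eventually_layerCutoff_eq_one hs.1 (lt_of_le_of_ne hs.2 hs1))
    refine tendsto_const_nhds.congr' ?_
    filter_upwards [h2] with j hj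
    rw [layerPow_eq (by positivity), hj, mul_one]

end Cutoff

section Final

variable {n : ℕ} (μ : Measure (V n)) [IsFiniteMeasure μ]

lemma Ppot_pos (hn : 3 ≤ n) (hμ : μ ≠ 0) (hle : ∀ x, Ppot n μ x ≤ 1) (x : V n) :
    0 < Ppot n μ x :=
  (regPot_pos μ hn one_pos hμ x).trans_le (regPot_le_Ppot μ hn one_pos hle x)

/-- The weighted energy of the equilibrium potential off the support. -/
theorem weighted_energy (hn : 3 ≤ n) (hμ : μ ≠ 0) (hle : ∀ x, Ppot n μ x ≤ 1)
    {e : Set (V n)} (he : IsCompact e) (hsupp : μ eᶜ = 0)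
    (hP1 : ∀ᵐ y ∂μ, Ppot n μ y = 1) (hPe : ∀ᵐ x, x ∈ e → Ppot n μ x = 1) {q : ℝ} (hq : -1 < q) :
    IntegrableOn (fun x => Ppot n μ x ^ q * ‖fderiv ℝ (Ppot n μ) x‖ ^ 2) eᶜ ∧
      ∫ x in eᶜ, Ppot n μ x ^ q * ‖fderiv ℝ (Ppot n μ) x‖ ^ 2
        = 1 / (q + 1) * μ.real Set.univ := by
  have hk : ∀ j : ℕ, (0 : ℝ) < (j : ℝ) + 1 := fun j => by positivity
  have hpos := Ppot_pos μ hn hμ hle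
  have hlayer : ∀ j : ℕ, _ := fun j =>
    layer_energy μ hn hμ hle he hsupp hP1 hPe (continuous_layerPow (q := q) (hk j))
      (fun s => layerPow_nonneg (hk j)) (s₀ := ((j : ℝ) + 1)⁻¹) (M := (exists_layerPow_le (hk j)).choose)
      (by positivity) (fun s hs => by
        rw [layerPow, layerCutoff_eq_zero, mul_zero]
        rwa [← le_inv_mul_iff₀ (hk j), mul_one])
      (by rw [layerPow, layerCutoff_eq_zero' (hk j).le le_rfl, mul_zero])
      (exists_layerPow_le (hk j)).choose_spec
  have hlim : ∀ x, Tendsto (fun j : ℕ => layerPow q ((j : ℝ) + 1) (Ppot n μ x) *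
      ‖fderiv ℝ (Ppot n μ) x‖ ^ 2) atTop
      (𝓝 (Ppot n μ x ^ q * ‖fderiv ℝ (Ppot n μ) x‖ ^ 2)) := by
    intro x
    rcases (hle x).lt_or_eq with h | h
    · have h2 := (tendsto_atTop_add_const_right _ (1 : ℝ)
        tendsto_natCast_atTop_atTop).eventually (eventually_layerCutoff_eq_one (hpos x) h)
      refine tendsto_const_nhds.congr' ?_
      filter_upwards [h2] with j hj
      rw [layerPow_eq (hk j), hj, mul_one]
    · have hmax : IsLocalMax (Ppot n μ) x := Eventually.of_forall fun y => (hle y).trans_eq h.symm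
      simp [hmax.fderiv_eq_zero]
  have hval := (tendsto_integral_layerPow hq).mul_const (μ.real Set.univ)
  have hmeas : ∀ j : ℕ, Measurable fun x => layerPow q ((j : ℝ) + 1) (Ppot n μ x) *
      ‖fderiv ℝ (Ppot n μ) x‖ ^ 2 := fun j =>
    ((continuous_layerPow (hk j)).measurable.comp (measurable_Ppot μ hn hle)).mul
      ((measurable_fderiv ℝ _).norm.pow_const 2)
  have hint := (integrable_and_integral_le_of_tendsto
    (Eventually.of_forall fun j => (hlayer j).1)
    (fun j x => mul_nonneg (layerPow_nonneg (hk j)) (by positivity)) hmeas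
    (ae_of_all _ hlim) (Eventually.of_forall fun j => (hlayer j).2.le) hval).1
  refine ⟨hint, ?_⟩
  have hmono := integral_tendsto_of_tendsto_of_monotone (fun j => (hlayer j).1) hint
    (ae_of_all _ fun x i j hij => ?_) (ae_of_all _ hlim)
  · refine tendsto_nhds_unique hmono (hval.congr fun j => ?_)
    exact (hlayer j).2.symm
  · have h1 := hpos x
    have h2 : layerCutoff ((i : ℝ) + 1) (Ppot n μ x) ≤ layerCutoff ((j : ℝ) + 1) (Ppot n μ x) :=
      layerCutoff_mono (by gcongr) h1.le (hle x)
    beta_reduce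
    rw [layerPow_eq (hk i), layerPow_eq (hk j)]
    gcongr

end Final

/-- Let `n ≥ 3`, `e` compact of positive capacity with equilibrium measure
`μ`, and `v = (Pμ)^τ` with `1 < 2τ < n/(n-2)`.  Then `v` belongs to the energy space
`L^{1,2}(ℝⁿ)` and `‖∇v‖_{L²} = τ (2τ-1)^{-1/2} cap(e)^{1/2}`. -/
theorem stmt_11 (n : ℕ) (hn : 3 ≤ n) (e : Set (V n)) (he : IsCompact e)
    (hcap : 0 < cap n e) (μ : Measure (V n)) [IsFiniteMeasure μ]
    (hsupp : μ eᶜ = 0)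
    (hle : ∀ x, Ppot n μ x ≤ 1)
    (hqe : ∀ k : Set (V n), IsCompact k → k ⊆ {x ∈ e | Ppot n μ x ≠ 1} → cap n k = 0)
    (hmass : μ e = ENNReal.ofReal (cap n e))
    (τ : ℝ) (hτ₁ : 1 < 2 * τ) (hτ₂ : 2 * τ < (n : ℝ) / ((n : ℝ) - 2)) :
    Integrable (fun x : V n => ‖fderiv ℝ (fun y => Ppot n μ y ^ τ) x‖ ^ 2) ∧
    (∫ x : V n, ‖fderiv ℝ (fun y => Ppot n μ y ^ τ) x‖ ^ 2) ^ ((1 : ℝ) / 2)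
      = τ * (2 * τ - 1) ^ (-(1 : ℝ) / 2) * Real.sqrt (cap n e) := by
  have hμ : μ ≠ 0 := by
    rintro rfl
    rw [Measure.coe_zero, Pi.zero_apply] at hmass
    exact (ENNReal.ofReal_pos.2 hcap).ne hmass
  have hpos := Ppot_pos μ hn hμ hle
  obtain ⟨hnull, hnullμ⟩ := null_exceptional μ hn hμ hle he hqe
  have hPe : ∀ᵐ x, x ∈ e → Ppot n μ x = 1 := by
    rw [ae_iff]
    simpa using hnull
  have hP1 : ∀ᵐ y ∂μ, Ppot n μ y = 1 := by
    have h1 : ∀ᵐ y ∂μ, y ∈ e := by rw [ae_iff]; exact hsupp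
    have h2 : ∀ᵐ y ∂μ, y ∈ e → Ppot n μ y = 1 := by
      rw [ae_iff]
      simpa using hnullμ
    filter_upwards [h1, h2] with y hy1 hy2 using hy2 hy1
  have hmass' : μ.real Set.univ = cap n e := by
    rw [Measure.real, ← measure_add_measure_compl he.measurableSet, hsupp, add_zero, hmass,
      ENNReal.toReal_ofReal hcap.le]
  have hem : MeasurableSet eᶜ := he.measurableSet.compl
  obtain ⟨hint, hval⟩ := weighted_energy μ hn hμ hle he hsupp hP1 hPe
    (q := 2 * τ - 2) (by linarith)
  set f : V n → ℝ := fun x => ‖fderiv ℝ (fun y => Ppot n μ y ^ τ) x‖ ^ 2 with hf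
  have hoff : ∀ x ∈ eᶜ, f x = τ ^ 2 *
      (Ppot n μ x ^ (2 * τ - 2) * ‖fderiv ℝ (Ppot n μ) x‖ ^ 2) := by
    intro x hx
    have hd := (hasFDerivAt_Ppot μ hn hle he.isClosed hsupp hx).1.hasFDerivAt
    have h1 := (hd.rpow_const (p := τ) (Or.inl (hpos x).ne')).fderiv
    have h2 : Ppot n μ x ^ (2 * τ - 2) = (Ppot n μ x ^ (τ - 1)) ^ 2 := by
      rw [← Real.rpow_natCast, ← Real.rpow_mul (hpos x).le]
      congr 1
      push_cast
      ring
    simp only [hf]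
    rw [h1, norm_smul, Real.norm_eq_abs, mul_pow, sq_abs, h2]
    ring
  have hon : ∀ᵐ x, x ∈ e → f x = 0 := by
    filter_upwards [hPe] with x hx hxe
    have hmax : IsLocalMax (fun y => Ppot n μ y ^ τ) x := Eventually.of_forall fun y => by
      change Ppot n μ y ^ τ ≤ Ppot n μ x ^ τ
      rw [hx hxe]
      exact Real.rpow_le_rpow (hpos y).le (hle y) (by linarith)
    simp [hf, hmax.fderiv_eq_zero]
  have hfi : IntegrableOn f eᶜ := (integrableOn_congr_fun hoff hem).2 (hint.const_mul _)
  have hfe : IntegrableOn f e := (integrable_congr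
    ((ae_restrict_iff' he.measurableSet).2 hon)).2 (integrable_zero _ _ _)
  refine ⟨?_, ?_⟩
  · rw [← integrableOn_univ, ← Set.union_compl_self e]
    exact hfe.union hfi
  · have hI : ∫ x, f x = τ ^ 2 * (1 / (2 * τ - 1) * cap n e) := by
      rw [← setIntegral_eq_integral_of_ae_compl_eq_zero (s := eᶜ)
        (hon.mono fun x hx hxe => hx (Set.notMem_compl_iff.1 hxe)),
        setIntegral_congr_fun hem hoff, integral_const_mul, hval, hmass',
        show 2 * τ - 2 + 1 = 2 * τ - 1 by ring]
    have hτ0 : 0 < τ := by linarith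
    have hτ1 : 0 < 2 * τ - 1 := by linarith
    rw [hI, Real.mul_rpow (by positivity) (by positivity), Real.mul_rpow (by positivity) hcap.le,
      ← Real.sqrt_eq_rpow, ← Real.sqrt_eq_rpow (cap n e), Real.sqrt_sq hτ0.le, one_div (2 * τ - 1),
      Real.inv_rpow hτ1.le, ← Real.rpow_neg hτ1.le, ← mul_assoc, neg_div]
end
end

section
/- Let n ≥ 3, let Q be a cube with center a and side length r, and let v ∈ C_c^∞(Q) with ∫_Q v dx = 0. Let η_j ∈ C_c^∞(2^{j+1}Q \ 2^{j-1}Q) satisfy 0 ≤ η_j ≤ 1 and |∇η_j| ≤ C(2^j r)^{-1}. Then for j ≥ 2: ‖∇(η_j Δ^{-1}v)‖_{L²(2^{j+1}Q)} ≤ C(n) 2^{-jn/2} |Q|^{1/n - 1/2} ‖v‖_{L¹(Q)}. -/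
open MeasureTheory

noncomputable section

/-- `u` is a smooth compactly supported (complex-valued) test function. -/
def IsTest {n : ℕ} (u : V n → ℂ) : Prop := ContDiff ℝ (⊤ : ℕ∞) u ∧ HasCompactSupport u

/-- The open cube with center `a` and side length `r`. -/
def cube {n : ℕ} (a : V n) (r : ℝ) : Set (V n) := {x | ∀ i, |x i - a i| < r / 2}

/-- The fundamental solution of the Laplacian on ℝⁿ (for `n ≥ 3`):
`-‖x‖^{2-n} / ((n-2) σ_{n-1})`, where `σ_{n-1} = n ω_n` is the unit-sphere area. -/
noncomputable def newtonKernel (n : ℕ) (x : V n) : ℝ :=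
  if n = 2 then Real.log ‖x‖ / (2 * Real.pi)
  else -‖x‖ ^ (2 - (n : ℝ)) /
    (((n : ℝ) - 2) * (n : ℝ) * (volume (Metric.ball (0 : V n) 1)).toReal)

/-- The Newtonian potential `Δ⁻¹ v`, i.e. convolution with the fundamental solution. -/
noncomputable def invLap {n : ℕ} (v : V n → ℂ) (x : V n) : ℂ :=
  ∫ y : V n, (newtonKernel n (x - y) : ℂ) * v y

section Kernel

variable {E : Type*} [NormedAddCommGroup E]

theorem abs_inv_norm_sub_inv_norm_le {x y : E} (hx : x ≠ 0) (hy : y ≠ 0) :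
    |‖x‖⁻¹ - ‖y‖⁻¹| ≤ ‖x - y‖ * (‖x‖⁻¹ * ‖y‖⁻¹) := by
  have hx' : 0 < ‖x‖ := norm_pos_iff.2 hx
  have hy' : 0 < ‖y‖ := norm_pos_iff.2 hy
  have h : ‖x‖⁻¹ - ‖y‖⁻¹ = (‖y‖ - ‖x‖) * (‖x‖⁻¹ * ‖y‖⁻¹) := by field_simp
  rw [h, abs_mul, abs_of_pos (by positivity : 0 < ‖x‖⁻¹ * ‖y‖⁻¹)]
  gcongr
  rw [norm_sub_rev]
  exact abs_norm_sub_norm_le y x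

theorem abs_inv_norm_pow_sub_le {ρ : ℝ} (hρ : 0 < ρ) (p : ℕ) {x y : E}
    (hx : ρ ≤ ‖x‖) (hy : ρ ≤ ‖y‖) :
    |‖x‖⁻¹ ^ p - ‖y‖⁻¹ ^ p| ≤ p * ρ⁻¹ ^ (p + 1) * ‖x - y‖ := by
  have hx' : ‖x‖⁻¹ ≤ ρ⁻¹ := inv_anti₀ hρ hx
  have hy' : ‖y‖⁻¹ ≤ ρ⁻¹ := inv_anti₀ hρ hy
  rcases p with _ | p
  · simp
  calc |‖x‖⁻¹ ^ (p + 1) - ‖y‖⁻¹ ^ (p + 1)|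
      ≤ |‖x‖⁻¹ - ‖y‖⁻¹| * (p + 1 : ℕ) * max |‖x‖⁻¹| |‖y‖⁻¹| ^ p := abs_pow_sub_pow_le _ _ _
    _ ≤ (‖x - y‖ * (ρ⁻¹ * ρ⁻¹)) * (p + 1 : ℕ) * ρ⁻¹ ^ p := by
        gcongr
        · refine (abs_inv_norm_sub_inv_norm_le (norm_pos_iff.1 (hρ.trans_le hx))
            (norm_pos_iff.1 (hρ.trans_le hy))).trans ?_
          gcongr
        · simp only [abs_inv, abs_norm]
          exact max_le hx' hy'
    _ = _ := by ring

variable [InnerProductSpace ℝ E]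

theorem norm_inv_norm_pow_smul_sub_le {ρ : ℝ} (hρ : 0 < ρ) (p : ℕ) {x y : E}
    (hx : ρ ≤ ‖x‖) (hy : ρ ≤ ‖y‖) :
    ‖‖x‖⁻¹ ^ (p + 1) • x - ‖y‖⁻¹ ^ (p + 1) • y‖ ≤ (p + 2) * ρ⁻¹ ^ (p + 1) * ‖x - y‖ := by
  have hx' : ‖x‖⁻¹ ≤ ρ⁻¹ := inv_anti₀ hρ hx
  have hy' : ‖y‖⁻¹ ≤ ρ⁻¹ := inv_anti₀ hρ hy
  have hx0 : 0 < ‖x‖ := hρ.trans_le hx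
  have hy0 : 0 < ‖y‖ := hρ.trans_le hy
  have hsplit : ‖x‖⁻¹ ^ (p + 1) • x - ‖y‖⁻¹ ^ (p + 1) • y
      = ‖x‖⁻¹ ^ (p + 1) • (x - y) + (‖x‖⁻¹ ^ (p + 1) - ‖y‖⁻¹ ^ (p + 1)) • y := by
    module
  have hpow : |‖x‖⁻¹ ^ (p + 1) - ‖y‖⁻¹ ^ (p + 1)|
      ≤ (‖x - y‖ * (ρ⁻¹ * ‖y‖⁻¹)) * (p + 1 : ℕ) * ρ⁻¹ ^ p := by
    refine (abs_pow_sub_pow_le _ _ _).trans ?_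
    rw [Nat.add_sub_cancel]
    gcongr
    · refine (abs_inv_norm_sub_inv_norm_le (norm_pos_iff.1 hx0) (norm_pos_iff.1 hy0)).trans ?_
      gcongr
    · simp only [abs_inv, abs_norm]
      exact max_le hx' hy'
  calc _ ≤ ‖x‖⁻¹ ^ (p + 1) * ‖x - y‖ + |‖x‖⁻¹ ^ (p + 1) - ‖y‖⁻¹ ^ (p + 1)| * ‖y‖ := by
        rw [hsplit]
        refine (norm_add_le _ _).trans ?_
        rw [norm_smul, norm_smul, Real.norm_eq_abs, Real.norm_eq_abs,
          abs_of_nonneg (by positivity : 0 ≤ ‖x‖⁻¹ ^ (p + 1))]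
    _ ≤ ρ⁻¹ ^ (p + 1) * ‖x - y‖
        + ((‖x - y‖ * (ρ⁻¹ * ‖y‖⁻¹)) * (p + 1 : ℕ) * ρ⁻¹ ^ p) * ‖y‖ := by
        gcongr
    _ = _ := by
        push_cast
        linear_combination (‖x - y‖ * ρ⁻¹ ^ (p + 1) * (p + 1)) * inv_mul_cancel₀ hy0.ne'

theorem hasFDerivAt_inv_norm_pow (p : ℕ) {x : E} (hx : x ≠ 0) :
    HasFDerivAt (fun z : E => ‖z‖⁻¹ ^ p)
      (-(p : ℝ) • innerSL ℝ (‖x‖⁻¹ ^ (p + 2) • x)) x := by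
  have hx' : 0 < ‖x‖ := norm_pos_iff.2 hx
  have hnorm : HasFDerivAt (fun z : E => ‖z‖) (‖x‖⁻¹ • innerSL ℝ x) x := by
    have h := ((hasStrictFDerivAt_norm_sq x).hasFDerivAt).sqrt (by positivity)
    simp only [Real.sqrt_sq (norm_nonneg _)] at h
    refine h.congr_fderiv ?_
    ext z
    simp
    field_simp
  have h := (((hasDerivAt_inv hx'.ne').pow p)).comp_hasFDerivAt x hnorm
  refine h.congr_fderiv ?_
  rcases p with _ | p
  · simp
  ext z
  simp
  field_simp
  ring

theorem abs_inv_norm_pow_second_difference_le {ρ : ℝ} (hρ : 0 < ρ) (p : ℕ) {x y s t : E} {B : Set E}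
    (hB : Convex ℝ B) (hx : x ∈ B) (hy : y ∈ B) (hs : ∀ z ∈ B, ρ ≤ ‖z - s‖)
    (ht : ∀ z ∈ B, ρ ≤ ‖z - t‖) :
    |(‖y - s‖⁻¹ ^ p - ‖y - t‖⁻¹ ^ p) - (‖x - s‖⁻¹ ^ p - ‖x - t‖⁻¹ ^ p)|
      ≤ p * (p + 3) * ρ⁻¹ ^ (p + 2) * ‖s - t‖ * ‖y - x‖ := by
  have hne : ∀ {z w : E}, ρ ≤ ‖z - w‖ → z - w ≠ 0 := fun h => norm_pos_iff.1 (hρ.trans_le h)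
  refine hB.norm_image_sub_le_of_norm_hasFDerivWithin_le (𝕜 := ℝ)
    (f := fun z => ‖z - s‖⁻¹ ^ p - ‖z - t‖⁻¹ ^ p)
    (f' := fun z => -(p : ℝ) • innerSL ℝ (‖z - s‖⁻¹ ^ (p + 2) • (z - s))
      - -(p : ℝ) • innerSL ℝ (‖z - t‖⁻¹ ^ (p + 2) • (z - t))) ?_ ?_ hx hy
  · intro z hz
    exact (((hasFDerivAt_inv_norm_pow p (hne (hs z hz))).comp z ((hasFDerivAt_id z).sub_const s)).sub
      ((hasFDerivAt_inv_norm_pow p (hne (ht z hz))).comp z ((hasFDerivAt_id z).sub_const t))).hasFDerivWithinAt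
  · intro z hz
    have h := norm_inv_norm_pow_smul_sub_le hρ (p + 1) (hs z hz) (ht z hz)
    rw [sub_sub_sub_cancel_left, norm_sub_rev t s] at h
    rw [← smul_sub, ← map_sub, norm_smul, innerSL_apply_norm, norm_neg, Real.norm_natCast]
    calc _ ≤ (p : ℝ) * (((p + 1 : ℕ) + 2) * ρ⁻¹ ^ (p + 1 + 1) * ‖s - t‖) := by gcongr
      _ = _ := by push_cast; ring

end Kernel

section Cube

variable {n : ℕ}

theorem isOpen_cube (a : V n) (r : ℝ) : IsOpen (cube a r) := by
  simp only [cube, Set.ofPred_forall]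
  exact isOpen_iInter_of_finite fun i => isOpen_lt (by fun_prop) continuous_const

theorem norm_sub_le_of_mem_cube {a t : V n} {r : ℝ} (hr : 0 < r) (ht : t ∈ cube a r) :
    ‖t - a‖ ≤ n * r := by
  have h : ‖t - a‖ ≤ ∑ i, |t i - a i| := by
    rw [EuclideanSpace.norm_eq]
    refine Real.sqrt_le_iff.2 ⟨by positivity, ?_⟩
    simpa using Finset.sum_sq_le_sq_sum_of_nonneg (s := Finset.univ)
      (f := fun i => |t i - a i|) (fun i _ => abs_nonneg _)
  refine h.trans ((Finset.sum_le_sum fun i _ => ?_).trans_eq (b := ∑ _i : Fin n, r) (by simp))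
  have := ht i
  linarith

theorem volume_cube (a : V n) {r : ℝ} (hr : 0 < r) :
    volume (cube a r) = ENNReal.ofReal (r ^ n) := by
  have h : cube a r = (MeasurableEquiv.toLp 2 (Fin n → ℝ)).symm ⁻¹'
      Metric.ball (fun i => a i) (r / 2) := by
    ext x
    simp [cube, dist_pi_lt_iff (half_pos hr), Real.dist_eq]
  rw [h, (EuclideanSpace.volume_preserving_symm_measurableEquiv_toLp (Fin n)).measure_preimage
    Metric.isOpen_ball.measurableSet.nullMeasurableSet, Real.volume_pi_ball _ (half_pos hr)]
  simp [mul_div_cancel₀]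

theorem le_norm_sub_of_notMem_cube {a x t : V n} {r s : ℝ} (hx : x ∉ cube a s)
    (ht : t ∈ cube a r) : (s - r) / 2 ≤ ‖x - t‖ := by
  simp only [cube, Set.mem_ofPred_eq, not_forall, not_lt] at hx
  obtain ⟨i, hi⟩ := hx
  have h1 := PiLp.norm_apply_le (x - t) i
  have h2 := ht i
  have h3 : |x i - a i| ≤ |x i - t i| + |t i - a i| := abs_sub_le _ _ _
  simp only [PiLp.sub_apply, Real.norm_eq_abs] at h1
  linarith

end Cube

section Potential

theorem norm_integral_mul_le_of_cancellation {X : Type*} [MeasurableSpace X] {μ : Measure X}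
    {v : X → ℂ} {k : X → ℝ} {Q : Set X} (hQ : MeasurableSet Q) (hv : Integrable v μ)
    (hk : Measurable k) (hvQ : ∀ t, t ∉ Q → v t = 0) (h0 : ∫ t in Q, v t ∂μ = 0) {k₀ M : ℝ}
    (hM : ∀ t ∈ Q, |k t - k₀| ≤ M) :
    Integrable (fun t => (k t : ℂ) * v t) μ ∧
      ‖∫ t, (k t : ℂ) * v t ∂μ‖ ≤ M * ∫ t in Q, ‖v t‖ ∂μ := by
  have hbd : ∀ᵐ t ∂μ.restrict Q, ‖((k t - k₀ : ℝ) : ℂ)‖ ≤ M := by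
    filter_upwards [ae_restrict_mem hQ] with t ht
    rw [Complex.norm_real]
    exact hM t ht
  have hdiff : IntegrableOn (fun t => ((k t - k₀ : ℝ) : ℂ) * v t) Q μ :=
    hv.integrableOn.bdd_mul (by fun_prop) hbd
  have hconst : IntegrableOn (fun t => (k₀ : ℂ) * v t) Q μ := hv.integrableOn.const_mul _
  have hsum : (fun t => (k t : ℂ) * v t)
      = fun t => ((k t - k₀ : ℝ) : ℂ) * v t + (k₀ : ℂ) * v t := by
    ext t; push_cast; ring
  have hzero : ∀ t, t ∉ Q → (k t : ℂ) * v t = 0 := fun t ht => by rw [hvQ t ht, mul_zero]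
  have hon : IntegrableOn (fun t => (k t : ℂ) * v t) Q μ := by
    rw [hsum]; exact hdiff.add hconst
  refine ⟨(integrableOn_iff_integrable_of_support_subset
    (fun t ht => by_contra fun h => ht (hzero t h))).1 hon, ?_⟩
  rw [← setIntegral_eq_integral_of_forall_compl_eq_zero hzero, hsum,
    integral_add hdiff hconst, integral_const_mul, h0, mul_zero, add_zero, ← integral_const_mul]
  refine norm_integral_le_of_norm_le (hv.norm.integrableOn.const_mul M) ?_
  filter_upwards [hbd] with t ht
  rw [norm_mul]
  gcongr

theorem newtonKernel_eq (n : ℕ) (hn : 3 ≤ n) :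
    ∃ c : ℝ, ∀ x : V n, newtonKernel n x = c * ‖x‖⁻¹ ^ (n - 2) := by
  refine ⟨-(((n : ℝ) - 2) * (n : ℝ) * (volume (Metric.ball (0 : V n) 1)).toReal)⁻¹, fun x => ?_⟩
  have h : ‖x‖ ^ (2 - (n : ℝ)) = ‖x‖⁻¹ ^ (n - 2) := by
    rw [show (2 - (n : ℝ)) = -((n - 2 : ℕ) : ℝ) by
      rw [Nat.cast_sub (by omega)]; push_cast; ring, Real.rpow_neg (norm_nonneg _),
      Real.rpow_natCast, inv_pow]
  rw [newtonKernel, if_neg (by omega), h]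
  ring

theorem norm_potential_le {n p : ℕ} {c : ℝ}
    (hK : ∀ x : V n, newtonKernel n x = c * ‖x‖⁻¹ ^ p) {a : V n} {r : ℝ} (hr : 0 < r)
    {v : V n → ℂ} (hv : Integrable v) (hvQ : ∀ t, t ∉ cube a r → v t = 0)
    (h0 : ∫ t in cube a r, v t = 0) {ρ : ℝ} (hρ : 0 < ρ) {x : V n}
    (hx : ∀ t ∈ cube a r, ρ ≤ ‖x - t‖) :
    Integrable (fun t => (newtonKernel n (x - t) : ℂ) * v t) ∧
      ‖invLap v x‖ ≤ |c| * p * n * ρ⁻¹ ^ (p + 1) * r * ∫ t in cube a r, ‖v t‖ := by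
  have ha : a ∈ cube a r := fun i => by simpa using hr
  refine norm_integral_mul_le_of_cancellation (isOpen_cube a r).measurableSet hv
    (k := fun t => newtonKernel n (x - t)) (k₀ := newtonKernel n (x - a))
    (by simp only [hK]; fun_prop) hvQ h0 fun t ht => ?_
  have h := abs_inv_norm_pow_sub_le hρ p (hx t ht) (hx a ha)
  rw [sub_sub_sub_cancel_left, norm_sub_rev a t] at h
  rw [hK, hK, ← mul_sub, abs_mul]
  calc _ ≤ |c| * (p * ρ⁻¹ ^ (p + 1) * (n * r)) := by
        gcongr
        refine h.trans ?_
        gcongr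
        exact norm_sub_le_of_mem_cube hr ht
    _ = _ := by ring

theorem norm_potential_sub_le {n p : ℕ} {c : ℝ}
    (hK : ∀ x : V n, newtonKernel n x = c * ‖x‖⁻¹ ^ p) {a : V n} {r : ℝ} (hr : 0 < r)
    {v : V n → ℂ} (hv : Integrable v) (hvQ : ∀ t, t ∉ cube a r → v t = 0)
    (h0 : ∫ t in cube a r, v t = 0) {ρ : ℝ} (hρ : 0 < ρ) {B : Set (V n)} (hB : Convex ℝ B)
    (hBQ : ∀ z ∈ B, ∀ t ∈ cube a r, ρ ≤ ‖z - t‖) {x y : V n} (hx : x ∈ B) (hy : y ∈ B) :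
    ‖invLap v y - invLap v x‖
      ≤ |c| * p * (p + 3) * n * ρ⁻¹ ^ (p + 2) * r * (∫ t in cube a r, ‖v t‖) * ‖y - x‖ := by
  have ha : a ∈ cube a r := fun i => by simpa using hr
  have hsub : invLap v y - invLap v x
      = ∫ t, ((newtonKernel n (y - t) - newtonKernel n (x - t) : ℝ) : ℂ) * v t := by
    rw [invLap, invLap, ← integral_sub (norm_potential_le hK hr hv hvQ h0 hρ (hBQ y hy)).1
      (norm_potential_le hK hr hv hvQ h0 hρ (hBQ x hx)).1]
    simp only [Complex.ofReal_sub, sub_mul]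
  rw [hsub]
  refine (norm_integral_mul_le_of_cancellation (isOpen_cube a r).measurableSet hv
    (k := fun t => newtonKernel n (y - t) - newtonKernel n (x - t))
    (k₀ := newtonKernel n (y - a) - newtonKernel n (x - a))
    (M := |c| * p * (p + 3) * n * ρ⁻¹ ^ (p + 2) * r * ‖y - x‖)
    (by simp only [hK]; fun_prop) hvQ h0 fun t ht => ?_).2.trans_eq (by ring)
  have h := abs_inv_norm_pow_second_difference_le hρ p hB hx hy
    (fun z hz => hBQ z hz t ht) (fun z hz => hBQ z hz a ha)
  simp only [hK]
  rw [show c * ‖y - t‖⁻¹ ^ p - c * ‖x - t‖⁻¹ ^ p - (c * ‖y - a‖⁻¹ ^ p - c * ‖x - a‖⁻¹ ^ p)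
      = c * ((‖y - t‖⁻¹ ^ p - ‖y - a‖⁻¹ ^ p) - (‖x - t‖⁻¹ ^ p - ‖x - a‖⁻¹ ^ p)) by ring, abs_mul]
  calc _ ≤ |c| * (p * (p + 3) * ρ⁻¹ ^ (p + 2) * (n * r) * ‖y - x‖) := by
        gcongr
        refine h.trans ?_
        gcongr
        exact norm_sub_le_of_mem_cube hr ht
    _ = _ := by ring

/-- Pointwise gradient bound for a cut-off potential, in terms of the distance to the cube. -/
theorem norm_fderiv_cutoff_mul_potential_le {n p : ℕ} {c : ℝ}
    (hK : ∀ x : V n, newtonKernel n x = c * ‖x‖⁻¹ ^ p) {a : V n} {r : ℝ} (hr : 0 < r)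
    {v : V n → ℂ} (hv : Integrable v) (hvQ : ∀ t, t ∉ cube a r → v t = 0)
    (h0 : ∫ t in cube a r, v t = 0) {ρ : ℝ} (hρ : 0 < ρ) {η : V n → ℝ}
    (hη : Differentiable ℝ η) (hη1 : ∀ x, |η x| ≤ 1) {b : ℝ}
    (hb : ∀ x, ‖fderiv ℝ η x‖ ≤ b * ρ⁻¹) {x : V n} (hx : ∀ t ∈ cube a r, 2 * ρ ≤ ‖x - t‖) :
    ‖fderiv ℝ (fun y => (η y : ℂ) * invLap v y) x‖
      ≤ |c| * p * n * (b + (p + 3)) * ρ⁻¹ ^ (p + 2) * r * ∫ t in cube a r, ‖v t‖ := by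
  have hb0 : 0 ≤ b * ρ⁻¹ := (norm_nonneg _).trans (hb x)
  have hb0' : 0 ≤ b := nonneg_of_mul_nonneg_left hb0 (inv_pos.2 hρ)
  have hI : 0 ≤ ∫ t in cube a r, ‖v t‖ := integral_nonneg fun t => norm_nonneg _
  have hBQ : ∀ z ∈ Metric.ball x ρ, ∀ t ∈ cube a r, ρ ≤ ‖z - t‖ := fun z hz t ht => by
    have h1 := hx t ht
    have h2 : ‖x - t‖ ≤ ‖x - z‖ + ‖z - t‖ := norm_sub_le_norm_sub_add_norm_sub _ _ _
    rw [mem_ball_iff_norm'] at hz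
    linarith
  refine norm_fderiv_le_of_lip' ℝ (by positivity) ?_
  filter_upwards [Metric.ball_mem_nhds x hρ] with y hy
  have hu := (norm_potential_le hK hr hv hvQ h0 hρ (hBQ y hy)).2
  have hsub := norm_potential_sub_le hK hr hv hvQ h0 hρ (convex_ball x ρ) hBQ
    (Metric.mem_ball_self hρ) hy
  have hηsub : |η y - η x| ≤ b * ρ⁻¹ * ‖y - x‖ :=
    convex_univ.norm_image_sub_le_of_norm_fderiv_le (fun z _ => hη z) (fun z _ => hb z)
      (Set.mem_univ x) (Set.mem_univ y)
  calc ‖(η y : ℂ) * invLap v y - (η x : ℂ) * invLap v x‖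
      = ‖((η y - η x : ℝ) : ℂ) * invLap v y + (η x : ℂ) * (invLap v y - invLap v x)‖ := by
        congr 1; push_cast; ring
    _ ≤ |η y - η x| * ‖invLap v y‖ + |η x| * ‖invLap v y - invLap v x‖ := by
        refine (norm_add_le _ _).trans ?_
        simp only [norm_mul, Complex.norm_real, Real.norm_eq_abs, le_refl]
    _ ≤ (b * ρ⁻¹ * ‖y - x‖)
          * (|c| * p * n * ρ⁻¹ ^ (p + 1) * r * ∫ t in cube a r, ‖v t‖)
        + 1 * (|c| * p * (p + 3) * n * ρ⁻¹ ^ (p + 2) * r * (∫ t in cube a r, ‖v t‖)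
          * ‖y - x‖) := by
        gcongr
        exact hη1 x
    _ = _ := by ring

end Potential

/-- Let `n ≥ 3`, `Q` a cube of side `r`, and `v ∈ C_c^∞(Q)` with
`∫_Q v = 0`.  If `η_j ∈ C_c^∞(2^{j+1}Q \ 2^{j-1}Q)` with `0 ≤ η_j ≤ 1` and
`|∇η_j| ≤ c₀ (2^j r)⁻¹`, then for `j ≥ 2`:
`‖∇(η_j Δ⁻¹v)‖_{L²(2^{j+1}Q)} ≤ C(n) 2^{-jn/2} |Q|^{1/n - 1/2} ‖v‖_{L¹(Q)}`. -/
theorem stmt_19 (n : ℕ) (hn : 3 ≤ n) (c₀ : ℝ) :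
    ∃ C : ℝ, ∀ (a : V n) (r : ℝ), 0 < r → ∀ (j : ℕ), 2 ≤ j →
      ∀ η : V n → ℝ, ContDiff ℝ (⊤ : ℕ∞) η →
        tsupport η ⊆ cube a (2 ^ (j + 1) * r) \ cube a (2 ^ (j - 1) * r) →
        (∀ x, 0 ≤ η x ∧ η x ≤ 1) →
        (∀ x, ‖fderiv ℝ η x‖ ≤ c₀ * (2 ^ j * r)⁻¹) →
      ∀ v : V n → ℂ, IsTest v → tsupport v ⊆ cube a r →
        (∫ x in cube a r, v x) = 0 →
        (∫ x in cube a (2 ^ (j + 1) * r),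
            ‖fderiv ℝ (fun y => (η y : ℂ) * invLap v y) x‖ ^ 2) ^ ((1 : ℝ) / 2)
          ≤ C * (2 : ℝ) ^ (-((j : ℝ) * (n : ℝ) / 2))
              * ((r ^ n) ^ ((1 : ℝ) / n - 1 / 2))
              * ∫ x in cube a r, ‖v x‖ := by
  obtain ⟨c, hc⟩ := newtonKernel_eq n hn
  refine ⟨|c| * (n - 2 : ℕ) * n * (|c₀| + ((n - 2 : ℕ) + 3)) * 16 ^ n * 2 ^ ((n : ℝ) / 2), ?_⟩
  intro a r hr j hj η hη hηsupp hη01 hηb v hv hvsupp hv0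
  set A : ℝ := |c| * (n - 2 : ℕ) * n * (|c₀| + ((n - 2 : ℕ) + 3))
  set I : ℝ := ∫ x in cube a r, ‖v x‖
  have hI0 : 0 ≤ I := integral_nonneg fun t => norm_nonneg _
  have hA0 : 0 ≤ A := by positivity
  have hR : 0 < 2 ^ j * r := by positivity
  set R : ℝ := 2 ^ j * r with hRdef
  have hpt : ∀ x, ‖fderiv ℝ (fun y => (η y : ℂ) * invLap v y) x‖
      ≤ A * (R / 16)⁻¹ ^ n * r * I := by
    intro x
    by_cases hx : x ∈ tsupport η
    · have hfar : ∀ t ∈ cube a r, 2 * (R / 16) ≤ ‖x - t‖ := fun t ht => by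
        refine le_trans ?_ (le_norm_sub_of_notMem_cube (hηsupp hx).2 ht)
        obtain ⟨i, rfl⟩ := Nat.exists_eq_add_of_le hj
        have h2 : (1 : ℝ) ≤ 2 ^ i := one_le_pow₀ one_le_two
        rw [hRdef, show 2 + i - 1 = i + 1 by omega, pow_add, pow_succ _ i]
        nlinarith
      have h := norm_fderiv_cutoff_mul_potential_le hc hr
        (hv.1.continuous.integrable_of_hasCompactSupport hv.2)
        (fun t ht => image_eq_zero_of_notMem_tsupport fun h => ht (hvsupp h)) hv0
        (by positivity : 0 < R / 16) (hη.differentiable (by simp))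
        (fun x => abs_le.2 ⟨by linarith [(hη01 x).1], (hη01 x).2⟩) (b := |c₀|)
        (fun x => (hηb x).trans (mul_le_mul (le_abs_self _)
          (inv_anti₀ (by positivity) (by linarith)) (by positivity) (by positivity))) hfar
      rwa [Nat.sub_add_cancel (by omega)] at h
    · have hzero : (fun y => (η y : ℂ) * invLap v y) =ᶠ[nhds x] fun _ => 0 := by
        filter_upwards [notMem_tsupport_iff_eventuallyEq.1 hx] with y hy
        simp [hy]
      rw [hzero.fderiv_eq]
      simp only [fderiv_fun_const, Pi.zero_apply, norm_zero]
      positivity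
  set M : ℝ := A * (R / 16)⁻¹ ^ n * r * I with hM
  have hM0 : 0 ≤ M := by positivity
  have hint : ∫ x in cube a (2 ^ (j + 1) * r),
      ‖fderiv ℝ (fun y => (η y : ℂ) * invLap v y) x‖ ^ 2 ≤ M ^ 2 * (2 * R) ^ n := by
    have hvol := volume_cube a (by positivity : 0 < 2 ^ (j + 1) * r)
    have h := norm_setIntegral_le_of_norm_le_const (μ := volume)
      (s := cube a (2 ^ (j + 1) * r)) (C := M ^ 2)
      (f := fun x => ‖fderiv ℝ (fun y => (η y : ℂ) * invLap v y) x‖ ^ 2)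
      (by rw [hvol]; exact ENNReal.ofReal_lt_top)
      (fun x _ => by
        rw [Real.norm_of_nonneg (by positivity)]
        gcongr
        exact hpt x)
    rw [measureReal_def, hvol, ENNReal.toReal_ofReal (by positivity)] at h
    refine ((Real.le_norm_self _).trans h).trans_eq ?_
    rw [hRdef]
    ring
  calc _ ≤ (M ^ 2 * (2 * R) ^ n) ^ ((1 : ℝ) / 2) :=
        Real.rpow_le_rpow (integral_nonneg fun x => by positivity) hint (by positivity)
    _ = M * (2 * R) ^ ((n : ℝ) / 2) := by
        rw [Real.mul_rpow (by positivity) (by positivity), ← Real.sqrt_eq_rpow,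
          Real.sqrt_sq hM0, ← Real.rpow_natCast, ← Real.rpow_mul (by positivity), mul_one_div]
    _ = _ := by
        have hn0 : (n : ℝ) ≠ 0 := by positivity
        have e1 : (r ^ n) ^ ((1 : ℝ) / n - 1 / 2) = r * (r ^ ((n : ℝ) / 2))⁻¹ := by
          rw [← Real.rpow_natCast, ← Real.rpow_mul hr.le, ← Real.rpow_neg hr.le,
            show (n : ℝ) * (1 / n - 1 / 2) = 1 + -((n : ℝ) / 2) by field_simp; ring,
            Real.rpow_add hr, Real.rpow_one]
        have e2 : (2 : ℝ) ^ (-((j : ℝ) * n / 2)) = (((2 : ℝ) ^ j) ^ ((n : ℝ) / 2))⁻¹ := by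
          rw [← Real.rpow_natCast, ← Real.rpow_mul zero_le_two, ← Real.rpow_neg zero_le_two,
            mul_div_assoc]
        have e3 : R ^ n = R ^ ((n : ℝ) / 2) * R ^ ((n : ℝ) / 2) := by
          rw [← Real.rpow_add hR, add_halves, Real.rpow_natCast]
        have e4 : R ^ ((n : ℝ) / 2) = ((2 : ℝ) ^ j) ^ ((n : ℝ) / 2) * r ^ ((n : ℝ) / 2) :=
          Real.mul_rpow (by positivity) hr.le
        have hP : 0 < R ^ ((n : ℝ) / 2) := by positivity
        rw [hM, e1, e2, Real.mul_rpow zero_le_two hR.le, inv_div, div_pow, e3]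
        calc _ = A * 16 ^ n * 2 ^ ((n : ℝ) / 2) * (R ^ ((n : ℝ) / 2))⁻¹ * r * I := by
              field_simp
          _ = _ := by rw [e4, mul_inv]; ring
end
end
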